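/- arXiv:2203.02701 — 5 statements merged into one kernel-verified Lean document; each statement's English description precedes it below -/
import Mathlib

section
/- Let t_1, …, t_n be indeterminates. Then, as an identity of formal power series: Σ_{λ ∈ 𝒫_n} s_λ(x) · det(t_j^{λ_i + j − i})_{1 ≤ i,j ≤ n} = det( x_j^{n−i} / (1 − x_j t_i) )_{1 ≤ i,j ≤ n} / det(x_j^{n−i})_{1 ≤ i,j ≤ n}, where in det(t_j^{λ_i + j − i}) the entries with λ_i + j − i < 0 are taken to be 0, and 1/(1 − x_j t_i) denotes the geometric series Σ_{k≥0} (x_j t_i)^k. -/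
/-!
STATEMENT 4: For indeterminates `t_1,…,t_n`, as formal power series in `x_1,…,x_n` and
`t_1,…,t_n`:
`Σ_{λ ∈ 𝒫_n} s_λ(x) · det(t_j^{λ_i+j-i}) = det(x_j^{n-i}/(1-x_j t_i)) / det(x_j^{n-i})`,
where entries `t_j^{λ_i+j-i}` with `λ_i+j-i < 0` are `0` and `1/(1-x_j t_i)` is the
geometric series `Σ_{k≥0} (x_j t_i)^k` (encoded by a `HasSum` hypothesis for `g i j`).
We work in `MvPowerSeries (Fin n ⊕ Fin n) ℚ` with `x_j = X (inl j)`, `t_i = X (inr i)`.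
The Schur polynomial is the unique `s λ` with `s λ * det(x_j^{n-i}) = det(x_j^{λ_i+n-i})`,
and the right-hand side ratio is the unique power series `R` with
`R * det(x_j^{n-i}) = det(x_j^{n-i} · g i j)`.
-/

/-- The standard (coefficientwise-discrete product) topology on formal power series. -/
noncomputable instance (σ R : Type*) : TopologicalSpace (MvPowerSeries σ R) :=
  @Pi.topologicalSpace (σ →₀ ℕ) (fun _ => R) (fun _ => ⊥)

/-! ### Topological preliminaries -/

namespace MvPowerSeries

instance {σ R : Type*} [CommRing R] : IsTopologicalRing (MvPowerSeries σ R) :=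
  letI : TopologicalSpace R := ⊥
  haveI : DiscreteTopology R := ⟨rfl⟩
  WithPiTopology.instIsTopologicalRing σ R

instance {σ R : Type*} : T3Space (MvPowerSeries σ R) :=
  letI : TopologicalSpace R := ⊥
  haveI : DiscreteTopology R := ⟨rfl⟩
  inferInstanceAs (T3Space ((σ →₀ ℕ) → R))

/-- A family of power series is summable if its orders tend to infinity, as measured by a
weight with finite sublevel sets. -/
theorem summable_of_le_order {σ R ι : Type*} [CommRing R] (f : ι → MvPowerSeries σ R)
    (w : ι → ℕ) (hw : ∀ N, {i | w i ≤ N}.Finite) (h : ∀ i, (w i : ℕ∞) ≤ (f i).order) :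
    Summable f := by
  let : TopologicalSpace R := ⊥
  refine (WithPiTopology.summable_iff_summable_coeff (f := f)).2 fun d => ?_
  refine summable_of_hasFiniteSupport ((hw d.degree).subset fun i hi => ?_)
  by_contra hlt
  refine hi (coeff_of_lt_order (lt_of_lt_of_le ?_ (h i)))
  exact_mod_cast not_le.1 hlt

theorem le_order_prod_X_pow {σ R ι : Type*} [CommRing R] [Fintype ι] (v : ι → σ) (e : ι → ℕ) :
    ((∑ i, e i : ℕ) : ℕ∞) ≤ (∏ i, (X (v i) : MvPowerSeries σ R) ^ e i).order := by
  refine le_trans ?_ (le_order_prod _ _)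
  push_cast
  exact Finset.sum_le_sum fun i _ => le_order_pow_of_constantCoeff_eq_zero _ (constantCoeff_X _)

theorem le_order_sum {σ R ι : Type*} [CommRing R] (s : Finset ι) (f : ι → MvPowerSeries σ R)
    (m : ℕ∞) (h : ∀ i ∈ s, m ≤ (f i).order) : m ≤ (∑ i ∈ s, f i).order := by
  refine le_order fun d hd => ?_
  rw [map_sum]
  exact Finset.sum_eq_zero fun i hi => coeff_of_lt_order (hd.trans_le (h i hi))

end MvPowerSeries

/-! ### Sorting -/

theorem finite_setOf_sum_le (n N : ℕ) : {k : Fin n → ℕ | ∑ i, k i ≤ N}.Finite :=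
  (Set.finite_Iic (fun _ : Fin n => N)).subset fun _ hk i =>
    (Finset.single_le_sum (fun _ _ => Nat.zero_le _) (Finset.mem_univ i)).trans hk

theorem StrictAnti.add_val_le {n : ℕ} {b : Fin n → ℕ} (hb : StrictAnti b) {i j : Fin n}
    (hij : i ≤ j) : b j + j ≤ b i + i := by
  obtain ⟨j, hj⟩ := j
  induction j with
  | zero =>
    have : i = ⟨0, hj⟩ := le_antisymm hij (Nat.zero_le _)
    rw [this]
  | succ j ih =>
    rcases hij.eq_or_lt with rfl | hlt
    · rfl
    · have h₁ := ih (by lia) (Nat.lt_succ_iff.1 hlt)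
      have h₂ : b ⟨j + 1, hj⟩ < b ⟨j, by lia⟩ := hb (Nat.lt_succ_self j)
      simp only at h₁ ⊢
      lia

/-- A strictly decreasing sequence is an antitone sequence plus the staircase. -/
theorem StrictAnti.exists_antitone_add {n : ℕ} {b : Fin n → ℕ} (hb : StrictAnti b) :
    ∃ l : Fin n → ℕ, Antitone l ∧ ∀ i, b i = l i + (n - 1 - i) := by
  have hle : ∀ i : Fin n, n - 1 - (i : ℕ) ≤ b i := fun i => by
    have hi := i.isLt
    have h := hb.add_val_le (i := i) (j := ⟨n - 1, by lia⟩) (by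
      rw [Fin.le_def]
      simp only
      lia)
    simp only at h
    lia
  refine ⟨fun i => b i - (n - 1 - i), fun i j hij => ?_, fun i => ?_⟩
  · have h := hb.add_val_le hij
    have h₁ := hle i
    have h₂ := hle j
    have h₃ := i.isLt
    have h₄ := j.isLt
    simp only
    lia
  · exact (Nat.sub_add_cancel (hle i)).symm

theorem Antitone.strictAnti_add_staircase {n : ℕ} {l : Fin n → ℕ} (hl : Antitone l) :
    StrictAnti fun i : Fin n => l i + (n - 1 - i) := fun i j hij => by
  have h := hl hij.le
  have h' : (i : ℕ) < j := hij
  have := j.isLt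
  simp only
  lia

theorem Function.Injective.exists_strictAnti_comp_perm {n : ℕ} {a : Fin n → ℕ}
    (ha : Function.Injective a) :
    ∃ (b : Fin n → ℕ) (w : Equiv.Perm (Fin n)), StrictAnti b ∧ ∀ i, a i = b (w i) := by
  have hmono : StrictMono (a ∘ Tuple.sort a) :=
    (Tuple.monotone_sort a).strictMono_of_injective (ha.comp (Tuple.sort a).injective)
  refine ⟨a ∘ Tuple.sort a ∘ Fin.rev, (Tuple.sort a).symm.trans Fin.revPerm,
    fun i j hij => hmono (Fin.rev_lt_rev.2 hij), fun i => ?_⟩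
  simp

theorem StrictAnti.eq_of_comp_perm_eq {n : ℕ} {b b' : Fin n → ℕ} (hb : StrictAnti b)
    (hb' : StrictAnti b') {w w' : Equiv.Perm (Fin n)} (h : ∀ i, b (w i) = b' (w' i)) :
    b = b' ∧ w = w' := by
  have hr : b = b' := by
    refine (hb.range_inj hb').1 ?_
    rw [← w.surjective.range_comp b, ← w'.surjective.range_comp b']
    exact congrArg Set.range (funext h)
  subst hr
  exact ⟨rfl, Equiv.ext fun i => hb.injective (h i)⟩

/-! ### Determinant expansions -/

section Determinants

variable {A : Type*} [CommRing A] {n : ℕ}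

/-- The term indexed by `k` in the row-multilinear expansion of
`det (x_j ^ (n - 1 - i) / (1 - x_j t_i))`. -/
noncomputable def cauchyTerm (x t : Fin n → A) (k : Fin n → ℕ) : A :=
  (∏ i, t i ^ k i) *
    (Matrix.of fun i j : Fin n => x j ^ ((n - 1 - (i : ℕ)) + k i)).det

theorem det_mul_geom_sum (x t : Fin n → A) (N : ℕ) :
    (Matrix.of fun i j : Fin n =>
        x j ^ (n - 1 - (i : ℕ)) * ∑ k ∈ Finset.range N, (x j * t i) ^ k).det
      = ∑ k ∈ Fintype.piFinset fun _ : Fin n => Finset.range N, cauchyTerm x t k := by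
  have h := (Matrix.detRowAlternating (n := Fin n) (R := A)).toMultilinearMap.map_sum_finset
    (fun (i : Fin n) (k : ℕ) => fun j : Fin n => x j ^ (n - 1 - (i : ℕ)) * (x j * t i) ^ k)
    (fun _ => Finset.range N)
  refine Eq.trans ?_ (h.trans (Finset.sum_congr rfl fun k _ => ?_))
  · refine congrArg Matrix.det ?_
    ext i j
    simp [Finset.mul_sum, Finset.sum_apply]
  · rw [cauchyTerm, ← Matrix.det_mul_column]
    refine congrArg Matrix.det ?_
    ext i j
    simp only [Matrix.of_apply]
    ring

theorem cauchyTerm_eq_zero (x t : Fin n → A) (k : Fin n → ℕ)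
    (hk : ¬ Function.Injective fun i : Fin n => (n - 1 - (i : ℕ)) + k i) :
    cauchyTerm x t k = 0 := by
  simp only [Function.Injective, not_forall] at hk
  obtain ⟨i, j, hij, hne⟩ := hk
  rw [cauchyTerm, Matrix.det_zero_of_row_eq hne, mul_zero]
  ext c
  simp only [Matrix.of_apply]
  rw [hij]

open Classical in
/-- The term of the Cauchy expansion indexed by a partition and a permutation. -/
noncomputable def partitionPermTerm (x t : Fin n → A)
    (p : {l : Fin n → ℕ // Antitone l} × Equiv.Perm (Fin n)) : A :=
  if ∀ i : Fin n, n - 1 - (i : ℕ) ≤ p.1.1 (p.2 i) + (n - 1 - (p.2 i : ℕ)) then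
    cauchyTerm x t fun i => p.1.1 (p.2 i) + (n - 1 - (p.2 i : ℕ)) - (n - 1 - (i : ℕ))
  else 0

theorem sum_partitionPermTerm (x t : Fin n → A) (l : {l : Fin n → ℕ // Antitone l}) :
    ∑ w, partitionPermTerm x t (l, w)
      = (Matrix.of fun i j : Fin n => x j ^ (l.1 i + (n - 1 - (i : ℕ)))).det *
        (Matrix.of fun i j : Fin n =>
          if (i : ℕ) ≤ l.1 i + (j : ℕ) then t j ^ (l.1 i + (j : ℕ) - (i : ℕ)) else 0).det := by
  rw [Matrix.det_apply (Matrix.of fun i j : Fin n =>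
    if (i : ℕ) ≤ l.1 i + (j : ℕ) then t j ^ (l.1 i + (j : ℕ) - (i : ℕ)) else 0), Finset.mul_sum]
  refine Finset.sum_congr rfl fun w _ => ?_
  have hiff : ∀ i : Fin n, n - 1 - (i : ℕ) ≤ l.1 (w i) + (n - 1 - (w i : ℕ)) ↔
      (w i : ℕ) ≤ l.1 (w i) + (i : ℕ) := fun i => by
    have := i.isLt
    have := (w i).isLt
    lia
  rw [partitionPermTerm]
  split_ifs with hc
  · have hdet : (Matrix.of fun i j : Fin n => x j ^ ((n - 1 - (i : ℕ)) +
          (l.1 (w i) + (n - 1 - (w i : ℕ)) - (n - 1 - (i : ℕ))))).det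
        = Equiv.Perm.sign w *
          (Matrix.of fun i j : Fin n => x j ^ (l.1 i + (n - 1 - (i : ℕ)))).det := by
      rw [← Matrix.det_permute]
      refine congrArg Matrix.det ?_
      ext i j
      simp only [Matrix.of_apply, Matrix.submatrix_apply, id]
      rw [Nat.add_sub_cancel' (hc i)]
    rw [cauchyTerm, hdet]
    have hprod : ∏ i, t i ^ (l.1 (w i) + (n - 1 - (w i : ℕ)) - (n - 1 - (i : ℕ)))
        = ∏ i, (Matrix.of fun i j : Fin n =>
          if (i : ℕ) ≤ l.1 i + (j : ℕ) then t j ^ (l.1 i + (j : ℕ) - (i : ℕ)) else 0) (w i) i := by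
      refine Finset.prod_congr rfl fun i _ => ?_
      simp only [Matrix.of_apply]
      rw [if_pos ((hiff i).1 (hc i))]
      congr 1
      have := i.isLt
      have := (w i).isLt
      lia
    rw [hprod, Units.smul_def, zsmul_eq_mul]
    ring
  · push Not at hc
    obtain ⟨i, hi⟩ := hc
    rw [Finset.prod_eq_zero (Finset.mem_univ i), smul_zero, mul_zero]
    simp only [Matrix.of_apply]
    exact if_neg fun h => (not_le.2 hi) ((hiff i).2 h)

/-- Sorting exponents turns a sum over all exponent vectors into a sum over pairs of a partition
and a permutation. -/
theorem HasSum.partitionPermTerm [TopologicalSpace A] {x t : Fin n → A} {a : A}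
    (h : HasSum (cauchyTerm x t) a) : HasSum (partitionPermTerm x t) a := by
  have hcond : ∀ p, _root_.partitionPermTerm x t p ≠ 0 →
      ∀ i : Fin n, n - 1 - (i : ℕ) ≤ p.1.1 (p.2 i) + (n - 1 - (p.2 i : ℕ)) := fun p hp => by
    by_contra hc
    exact hp (if_neg hc)
  refine (hasSum_iff_hasSum_of_ne_zero_bij
    (fun p : Function.support (_root_.partitionPermTerm x t) => fun i =>
      p.1.1.1 (p.1.2 i) + (n - 1 - (p.1.2 i : ℕ)) - (n - 1 - (i : ℕ))) ?_ ?_ ?_).1 h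
  · rintro ⟨⟨l, w⟩, hp⟩ ⟨⟨l', w'⟩, hp'⟩ heq
    have hc := hcond _ hp
    have hc' := hcond _ hp'
    have key := l.2.strictAnti_add_staircase.eq_of_comp_perm_eq
      l'.2.strictAnti_add_staircase (w := w) (w' := w') fun i => by
        have h₀ := congrFun heq i
        have h₁ := hc i
        have h₂ := hc' i
        simp only at h₀ h₁ h₂ ⊢
        lia
    have hl : l = l' := Subtype.ext (funext fun i => Nat.add_right_cancel (congrFun key.1 i))
    exact Subtype.ext (Prod.ext hl key.2)
  · intro k hk
    have hinj : Function.Injective fun i : Fin n => (n - 1 - (i : ℕ)) + k i := by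
      by_contra hc
      exact hk (cauchyTerm_eq_zero x t k hc)
    obtain ⟨b, w, hb, hw⟩ := hinj.exists_strictAnti_comp_perm
    obtain ⟨l, hl, hbl⟩ := hb.exists_antitone_add
    have hval : ∀ i : Fin n, l (w i) + (n - 1 - (w i : ℕ)) = (n - 1 - (i : ℕ)) + k i :=
      fun i => by rw [← hbl, ← hw]
    have hk' : (fun i : Fin n => l (w i) + (n - 1 - (w i : ℕ)) - (n - 1 - (i : ℕ))) = k :=
      funext fun i => by rw [hval, Nat.add_sub_cancel_left]
    have hterm : _root_.partitionPermTerm x t (⟨l, hl⟩, w) = cauchyTerm x t k := by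
      rw [_root_.partitionPermTerm, if_pos fun i => by
        simp only
        rw [hval]
        exact Nat.le_add_right _ _]
      exact congrArg _ hk'
    exact ⟨⟨(⟨l, hl⟩, w), by rw [Function.mem_support, hterm]; exact hk⟩, hk'⟩
  · rintro ⟨p, hp⟩
    exact (if_pos (hcond p hp)).symm

theorem det_pow_staircase_ne_zero [IsDomain A] {x : Fin n → A} (hx : Function.Injective x) :
    (Matrix.of fun i j : Fin n => x j ^ (n - 1 - (i : ℕ))).det ≠ 0 := by
  have h : (Matrix.of fun i j : Fin n => x j ^ (n - 1 - (i : ℕ)))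
      = (Matrix.vandermonde x).transpose.submatrix Fin.revPerm id := by
    ext i j
    simp only [Matrix.of_apply, Matrix.submatrix_apply, Matrix.transpose_apply,
      Matrix.vandermonde_apply, Fin.revPerm_apply, Fin.val_rev, id]
    congr 1
    lia
  rw [h, Matrix.det_permute, Matrix.det_transpose]
  refine mul_ne_zero ?_ (Matrix.det_vandermonde_ne_zero_iff.2 hx)
  rcases Int.units_eq_one_or (Equiv.Perm.sign (Fin.revPerm : Equiv.Perm (Fin n))) with h | h <;>
    simp [h]

end Determinants

/-! ### The identity in power series -/

namespace MvPowerSeries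

variable {σ S : Type*} [CommRing S] {n : ℕ}

theorem summable_cauchyTerm (x : Fin n → MvPowerSeries σ S) (v : Fin n → σ) :
    Summable (cauchyTerm x fun i => X (v i)) :=
  summable_of_le_order _ (fun k => ∑ i, k i) (finite_setOf_sum_le n) fun k =>
    ((le_order_prod_X_pow v k).trans le_self_add).trans le_order_mul

theorem hasSum_cauchyTerm (x : Fin n → MvPowerSeries σ S) (v : Fin n → σ)
    (g : Fin n → Fin n → MvPowerSeries σ S)
    (hg : ∀ i j, HasSum (fun k : ℕ => (x j * X (v i)) ^ k) (g i j)) :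
    HasSum (cauchyTerm x fun i => X (v i))
      (Matrix.of fun i j : Fin n => x j ^ (n - 1 - (i : ℕ)) * g i j).det := by
  have hs := (summable_cauchyTerm x v).hasSum
  have hbox : Filter.Tendsto
      (fun N => Fintype.piFinset fun _ : Fin n => Finset.range N) Filter.atTop Filter.atTop := by
    refine Filter.tendsto_atTop_finset_of_monotone
      (fun a b hab => Fintype.piFinset_subset _ _ fun _ => Finset.range_mono hab) fun k => ?_
    refine ⟨∑ i, k i + 1, Fintype.mem_piFinset.2 fun i => Finset.mem_range.2 ?_⟩
    exact Nat.lt_succ_of_le (Finset.single_le_sum (fun _ _ => Nat.zero_le _) (Finset.mem_univ i))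
  have h₁ := hs.comp hbox
  have h₂ : Filter.Tendsto (fun N => (Matrix.of fun i j : Fin n =>
      x j ^ (n - 1 - (i : ℕ)) * ∑ k ∈ Finset.range N, (x j * X (v i)) ^ k).det) Filter.atTop
      (nhds (Matrix.of fun i j : Fin n => x j ^ (n - 1 - (i : ℕ)) * g i j).det) := by
    have hdet : Continuous (Matrix.det : Matrix (Fin n) (Fin n) (MvPowerSeries σ S) → _) :=
      continuous_id.matrix_det
    refine (hdet.tendsto _).comp (tendsto_pi_nhds.2 fun i => tendsto_pi_nhds.2 fun j => ?_)
    exact (hg i j).tendsto_sum_nat.const_mul _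
  have h₃ := tendsto_nhds_unique (h₁.congr fun N => (det_mul_geom_sum x _ N).symm) h₂
  rwa [h₃] at hs

theorem sum_le_order_det (v : Fin n → σ) (l : Fin n → ℕ) :
    ((∑ i, l i : ℕ) : ℕ∞) ≤ (Matrix.of fun i j : Fin n =>
      if (i : ℕ) ≤ l i + (j : ℕ) then (X (v j) : MvPowerSeries σ S) ^ (l i + (j : ℕ) - (i : ℕ))
      else 0).det.order := by
  rw [Matrix.det_apply]
  refine le_order_sum _ _ _ fun w _ => ?_
  rw [Units.smul_def, zsmul_eq_mul]
  refine le_trans ?_ le_order_mul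
  refine le_trans ?_ le_add_self
  simp only [Matrix.of_apply]
  by_cases hc : ∀ i : Fin n, (w i : ℕ) ≤ l (w i) + (i : ℕ)
  · rw [Finset.prod_congr rfl fun i _ => if_pos (hc i)]
    refine le_trans (Nat.cast_le.2 ?_) (le_order_prod_X_pow v _)
    have h₁ : ∑ i, (l (w i) + (i : ℕ) - (w i : ℕ)) + ∑ i, (w i : ℕ)
        = ∑ i, l (w i) + ∑ i : Fin n, (i : ℕ) := by
      rw [← Finset.sum_add_distrib, ← Finset.sum_add_distrib]
      exact Finset.sum_congr rfl fun i _ => Nat.sub_add_cancel (hc i)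
    rw [Equiv.sum_comp w l, Equiv.sum_comp w fun i : Fin n => (i : ℕ)] at h₁
    exact (Nat.add_right_cancel h₁).ge
  · push Not at hc
    obtain ⟨i, hi⟩ := hc
    rw [Finset.prod_eq_zero (Finset.mem_univ i) (if_neg (not_le.2 hi))]
    simp

end MvPowerSeries

theorem stmt_4 (n : ℕ)
    (s : (Fin n → ℕ) → MvPolynomial (Fin n) ℚ)
    (hs : ∀ lam : Fin n → ℕ, Antitone lam →
      s lam * (Matrix.of fun i j : Fin n =>
          (MvPolynomial.X j : MvPolynomial (Fin n) ℚ) ^ (n - 1 - (i : ℕ))).det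
        = (Matrix.of fun i j : Fin n =>
          (MvPolynomial.X j : MvPolynomial (Fin n) ℚ) ^ (lam i + (n - 1 - (i : ℕ)))).det)
    (g : Fin n → Fin n → MvPowerSeries (Fin n ⊕ Fin n) ℚ)
    (hg : ∀ i j : Fin n, HasSum
      (fun k : ℕ => (MvPowerSeries.X (Sum.inl j) * MvPowerSeries.X (Sum.inr i) :
        MvPowerSeries (Fin n ⊕ Fin n) ℚ) ^ k) (g i j))
    (R : MvPowerSeries (Fin n ⊕ Fin n) ℚ)
    (hR : R * (Matrix.of fun i j : Fin n =>
          (MvPowerSeries.X (Sum.inl j) : MvPowerSeries (Fin n ⊕ Fin n) ℚ) ^ (n - 1 - (i : ℕ))).det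
        = (Matrix.of fun i j : Fin n =>
          (MvPowerSeries.X (Sum.inl j) : MvPowerSeries (Fin n ⊕ Fin n) ℚ) ^ (n - 1 - (i : ℕ)) *
            g i j).det) :
    HasSum
      (fun lam : {l : Fin n → ℕ // Antitone l} =>
        (MvPolynomial.coeToMvPowerSeries.ringHom
            (MvPolynomial.rename (Sum.inl : Fin n → Fin n ⊕ Fin n) (s lam.1)) :
          MvPowerSeries (Fin n ⊕ Fin n) ℚ) *
        (Matrix.of fun i j : Fin n =>
          if (i : ℕ) ≤ lam.1 i + (j : ℕ) then
            (MvPowerSeries.X (Sum.inr j) : MvPowerSeries (Fin n ⊕ Fin n) ℚ) ^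
              (lam.1 i + (j : ℕ) - (i : ℕ))
          else 0).det)
      R := by
  set x : Fin n → MvPowerSeries (Fin n ⊕ Fin n) ℚ := fun j => MvPowerSeries.X (Sum.inl j) with hx
  set V := (Matrix.of fun i j : Fin n => x j ^ (n - 1 - (i : ℕ))).det with hV
  have hxinj : Function.Injective x := fun a b hab =>
    Sum.inl_injective (MvPowerSeries.X_inj.1 hab)
  have : IsDomain (MvPowerSeries (Fin n ⊕ Fin n) ℚ) := NoZeroDivisors.to_isDomain _
  have hV0 : V ≠ 0 := det_pow_staircase_ne_zero hxinj
  let φ : MvPolynomial (Fin n) ℚ →+* MvPowerSeries (Fin n ⊕ Fin n) ℚ :=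
    MvPolynomial.coeToMvPowerSeries.ringHom.comp
      (MvPolynomial.rename (Sum.inl : Fin n → Fin n ⊕ Fin n)).toRingHom
  have hφX : ∀ j, φ (MvPolynomial.X j) = x j := fun j => by simp [φ, hx]
  have hφdet : ∀ e : Fin n → ℕ,
      φ (Matrix.of fun i j : Fin n => (MvPolynomial.X j : MvPolynomial (Fin n) ℚ) ^ e i).det
        = (Matrix.of fun i j : Fin n => x j ^ e i).det := fun e => by
    rw [RingHom.map_det]
    refine congrArg Matrix.det ?_
    ext1 i j
    simp [hφX]
  have hschur : ∀ l : Fin n → ℕ, Antitone l → φ (s l) * V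
      = (Matrix.of fun i j : Fin n => x j ^ (l i + (n - 1 - (i : ℕ)))).det := fun l hl => by
    rw [hV, ← hφdet, ← hφdet, ← map_mul, hs l hl]
  have htotal := ((MvPowerSeries.hasSum_cauchyTerm x Sum.inr g hg).partitionPermTerm).prod_fiberwise
    fun l => hasSum_fintype _
  simp only [sum_partitionPermTerm] at htotal
  rw [← hR] at htotal
  have hsummable : Summable fun lam : {l : Fin n → ℕ // Antitone l} =>
      φ (s lam.1) * (Matrix.of fun i j : Fin n =>
          if (i : ℕ) ≤ lam.1 i + (j : ℕ) then
            (MvPowerSeries.X (Sum.inr j) : MvPowerSeries (Fin n ⊕ Fin n) ℚ) ^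
              (lam.1 i + (j : ℕ) - (i : ℕ))
          else 0).det :=
    MvPowerSeries.summable_of_le_order _ (fun l => ∑ i, l.1 i)
      (fun N => (finite_setOf_sum_le n N).preimage Subtype.val_injective.injOn) fun l =>
      ((MvPowerSeries.sum_le_order_det Sum.inr l.1).trans le_add_self).trans
        MvPowerSeries.le_order_mul
  have hmul := hsummable.hasSum.mul_right V
  simp only [mul_right_comm _ _ V, hschur _ (Subtype.prop _)] at hmul
  have heq := hmul.unique htotal
  rw [← mul_right_cancel₀ hV0 heq]
  exact hsummable.hasSum
end

section
/- (Cauchy identity) As an identity of formal power series in x_1,…,x_n and y_1,…,y_m: Σ_{λ ∈ 𝒫_n} s_λ(x) · s_λ(y) = Π_{i=1}^n Π_{j=1}^m 1/(1 − x_i y_j), where the sum is over all partitions λ of length at most n, and s_λ(y) is computed in the m variables y (it is 0 when λ has more than m nonzero parts), and 1/(1 − x_i y_j) denotes the geometric series Σ_{k≥0} (x_i y_j)^k. -/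
section InfiniteCauchyBinet

open Filter Topology

variable {A : Type*} [CommRing A] [TopologicalSpace A] [IsTopologicalRing A] [T2Space A]

theorem hasSum_prod_of_summable {n : ℕ} {f : Fin n → ℕ → A} {a : Fin n → A}
    (hf : ∀ i, HasSum (f i) (a i)) (hs : Summable fun p : Fin n → ℕ => ∏ i, f i (p i)) :
    HasSum (fun p : Fin n → ℕ => ∏ i, f i (p i)) (∏ i, a i) := by
  classical
  have h_box : Tendsto (fun N : ℕ => Fintype.piFinset fun _ : Fin n => Finset.range N)
      atTop atTop := by
    refine tendsto_atTop_finset_of_monotone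
      (fun M N h => Fintype.piFinset_subset _ _ fun _ => Finset.range_mono h) fun p => ?_
    refine ⟨(∑ i, p i) + 1, Fintype.mem_piFinset.2 fun i => Finset.mem_range.2 ?_⟩
    exact Nat.lt_succ_of_le (Finset.single_le_sum (fun _ _ => Nat.zero_le _) (Finset.mem_univ i))
  have h_partial : Tendsto (fun N : ℕ => ∏ i, ∑ k ∈ Finset.range N, f i k) atTop (𝓝 (∏ i, a i)) :=
    tendsto_finsetProd _ fun i _ => (hf i).tendsto_sum_nat
  simp only [Finset.prod_univ_sum] at h_partial
  rw [← tendsto_nhds_unique (hs.hasSum.comp h_box) h_partial]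
  exact hs.hasSum

theorem strictAnti_add_sub {n : ℕ} {l : Fin n → ℕ} (hl : Antitone l) :
    StrictAnti fun i : Fin n => l i + (n - 1 - (i : ℕ)) := by
  intro i j hij
  have := hl hij.le
  have h : (i : ℕ) < j := hij
  dsimp only
  omega

theorem StrictAnti.sub_le_apply {n : ℕ} {k : Fin n → ℕ} (hk : StrictAnti k) (i : Fin n) :
    n - 1 - (i : ℕ) ≤ k i := by
  have h : ((Finset.Ioi i).image k).card ≤ (Finset.range (k i)).card := by
    refine Finset.card_le_card fun x hx => ?_
    obtain ⟨j, hj, rfl⟩ := Finset.mem_image.1 hx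
    exact Finset.mem_range.2 (hk (Finset.mem_Ioi.1 hj))
  rwa [Finset.card_image_of_injective _ hk.injective, Fin.card_Ioi, Finset.card_range] at h

theorem StrictAnti.antitone_sub {n : ℕ} {k : Fin n → ℕ} (hk : StrictAnti k) :
    Antitone fun i : Fin n => k i - (n - 1 - (i : ℕ)) := by
  intro i j hij
  have h : ((Finset.Ico i j).image k).card ≤ (Finset.Ioc (k j) (k i)).card := by
    refine Finset.card_le_card fun x hx => ?_
    obtain ⟨l, hl, rfl⟩ := Finset.mem_image.1 hx
    rw [Finset.mem_Ico] at hl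
    exact Finset.mem_Ioc.2 ⟨hk hl.2, hk.antitone hl.1⟩
  rw [Finset.card_image_of_injective _ hk.injective, Fin.card_Ico, Nat.card_Ioc] at h
  have := hk.antitone hij
  have := hk.sub_le_apply i
  have := hk.sub_le_apply j
  have h : (i : ℕ) ≤ j := hij
  dsimp only
  omega

/-- The tuple with entries `l i + (n - 1 - i)`, permuted by `τ`. -/
def shiftedPerm (n : ℕ) (p : {l : Fin n → ℕ // Antitone l} × Equiv.Perm (Fin n)) : Fin n → ℕ :=
  fun j => p.1.1 (p.2 j) + (n - 1 - (p.2 j : ℕ))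

theorem shiftedPerm_injective (n : ℕ) : Function.Injective (shiftedPerm n) := by
  rintro ⟨⟨l, hl⟩, σ⟩ ⟨⟨l', hl'⟩, τ⟩ h
  have hk := strictAnti_add_sub hl
  have hk' := strictAnti_add_sub hl'
  set k : Fin n → ℕ := fun i => l i + (n - 1 - (i : ℕ)) with hkdef
  set k' : Fin n → ℕ := fun i => l' i + (n - 1 - (i : ℕ)) with hkdef'
  have h' : k ∘ σ = k' ∘ τ := h
  have hkk : k = k' := by
    have e : k' = (k ∘ σ) ∘ τ.symm := by rw [h']; ext; simp
    have := Tuple.unique_monotone (f := k ∘ σ) (σ := Fin.revPerm.trans σ.symm)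
      (τ := Fin.revPerm.trans τ.symm)
      (by intro a b hab; simpa using hk.antitone (Fin.rev_le_rev.2 hab))
      (by rw [h']; intro a b hab; simpa using hk'.antitone (Fin.rev_le_rev.2 hab))
    ext i
    have := congrFun this (Fin.rev i)
    rw [e]
    simpa using this
  have hll : l = l' := by
    ext i
    have := congrFun hkk i
    simp only [hkdef, hkdef'] at this
    omega
  subst hll
  have : σ = τ := by
    ext i
    exact congrArg _ (hk.injective (congrFun h' i))
  rw [this]

theorem mem_range_shiftedPerm {n : ℕ} {κ : Fin n → ℕ} (hκ : Function.Injective κ) :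
    κ ∈ Set.range (shiftedPerm n) := by
  set τ : Equiv.Perm (Fin n) := Fin.revPerm.trans (Tuple.sort κ)
  have hk : StrictAnti (κ ∘ τ) := by
    refine Antitone.strictAnti_of_injective ?_ (hκ.comp τ.injective)
    intro a b hab
    exact Tuple.monotone_sort κ (Fin.rev_le_rev.2 hab)
  refine ⟨⟨⟨_, hk.antitone_sub⟩, τ.symm⟩, ?_⟩
  ext j
  have := hk.sub_le_apply (τ.symm j)
  simp only [shiftedPerm, Function.comp_apply, Equiv.apply_symm_apply] at this ⊢
  omega

/-- The Cauchy–Binet formula for matrices with countably infinite inner dimension. -/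
theorem hasSum_det_mul_det {n : ℕ} {c : Fin n → ℕ → A} {x : ℕ → Fin n → A}
    {F : Matrix (Fin n) (Fin n) A} (hF : ∀ i j, HasSum (fun k => c i k * x k j) (F i j))
    (hs : ∀ σ : Equiv.Perm (Fin n), Summable fun p : Fin n → ℕ => ∏ j, c (σ j) (p j) * x (p j) j) :
    HasSum (fun l : {l : Fin n → ℕ // Antitone l} =>
      (Matrix.of fun i j : Fin n => x (l.1 i + (n - 1 - (i : ℕ))) j).det *
      (Matrix.of fun i j : Fin n => c j (l.1 i + (n - 1 - (i : ℕ)))).det) F.det := by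
  have h_tuples : HasSum (fun κ : Fin n → ℕ =>
      (∏ j, x (κ j) j) * (Matrix.of fun i j : Fin n => c i (κ j)).det) F.det := by
    rw [Matrix.det_apply']
    have := hasSum_sum fun (σ : Equiv.Perm (Fin n)) (_ : σ ∈ Finset.univ) =>
      (hasSum_prod_of_summable (fun j => hF (σ j) j) (hs σ)).mul_left ((σ.sign : ℤ) : A)
    refine this.congr_fun ?_
    intro κ
    rw [Matrix.det_apply', Finset.mul_sum]
    refine Finset.sum_congr rfl fun σ _ => ?_
    simp only [Finset.prod_mul_distrib, Matrix.of_apply]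
    ring
  rw [← (shiftedPerm_injective n).hasSum_iff] at h_tuples
  · refine h_tuples.prod_fiberwise fun l => ?_
    convert hasSum_fintype _ using 1
    rw [Matrix.det_apply', Finset.sum_mul]
    refine Finset.sum_congr rfl fun τ _ => ?_
    have : (Matrix.of fun i j : Fin n => c i (shiftedPerm n (l, τ) j)).det =
        ((τ.sign : ℤ) : A) * (Matrix.of fun i j : Fin n => c j (l.1 i + (n - 1 - (i : ℕ)))).det := by
      rw [← Matrix.det_transpose (Matrix.of fun i j : Fin n => c j (l.1 i + (n - 1 - (i : ℕ)))),
        ← Matrix.det_permute']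
      rfl
    simp only [Function.comp_apply, this, Matrix.of_apply]
    simp only [shiftedPerm]
    ring
  · intro κ hκ
    have : ¬ Function.Injective κ := fun h => hκ (mem_range_shiftedPerm h)
    simp only [Function.Injective, not_forall] at this
    obtain ⟨i, j, hij, hne⟩ := this
    rw [Matrix.det_zero_of_column_eq hne, mul_zero]
    intro a
    simp [hij]

end InfiniteCauchyBinet

namespace MvPowerSeries

variable {σ R : Type*} [CommRing R]

instance : IsTopologicalRing (MvPowerSeries σ R) := by
  let _ : TopologicalSpace R := ⊥
  have _ : DiscreteTopology R := ⟨rfl⟩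
  exact WithPiTopology.instIsTopologicalRing σ R

instance : T2Space (MvPowerSeries σ R) := by
  let _ : TopologicalSpace R := ⊥
  have _ : DiscreteTopology R := ⟨rfl⟩
  exact WithPiTopology.instT2Space

theorem summable_of_finite_coeff_ne_zero {ι : Type*} {f : ι → MvPowerSeries σ R}
    (hf : ∀ d, {i | coeff d (f i) ≠ 0}.Finite) : Summable f := by
  let _ : TopologicalSpace R := ⊥
  refine Pi.summable.2 fun d => ?_
  exact summable_of_hasFiniteSupport (hf d)

theorem summable_of_X_pow_dvd {n : ℕ} {e : Fin n → σ} {f : (Fin n → ℕ) → MvPowerSeries σ R}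
    (hf : ∀ p i, X (e i) ^ p i ∣ f p) : Summable f := by
  refine summable_of_finite_coeff_ne_zero fun d => ?_
  refine (Set.finite_Iic fun i => d (e i)).subset fun p hp i => ?_
  by_contra h
  exact hp (X_pow_dvd_iff.1 (hf p i) d (not_le.1 h))

end MvPowerSeries

namespace MvPolynomial

variable {σ τ R : Type*} [CommRing R]

theorem rename_hsymm_mem_pow_idealOfVars [Fintype σ] [DecidableEq σ] (f : σ → τ) (k : ℕ) :
    rename f (hsymm σ R k) ∈ idealOfVars τ R ^ k := by
  have h : ∀ s : Multiset σ, (s.map fun i => (X (f i) : MvPolynomial τ R)).prod ∈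
      idealOfVars τ R ^ Multiset.card s := by
    intro s
    induction s using Multiset.induction_on with
    | empty => simp
    | cons a s ih =>
      rw [Multiset.map_cons, Multiset.prod_cons, Multiset.card_cons, pow_succ']
      exact Ideal.mul_mem_mul (Ideal.subset_span ⟨f a, rfl⟩) ih
  rw [hsymm, map_sum]
  refine Ideal.sum_mem _ fun s _ => ?_
  rw [map_multiset_prod, Multiset.map_map]
  simp only [Function.comp_def, rename_X]
  convert h s.1
  exact s.2.symm

/-- The Jacobi–Trudi determinant, with its variables renamed by `f`, vanishes to order at least
`l i - i` for every row `i`. -/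
theorem rename_det_hsymm_mem_pow_idealOfVars [Fintype σ] [DecidableEq σ] (f : σ → τ) {n : ℕ}
    (l : Fin n → ℕ) (i : Fin n) :
    rename f (Matrix.of fun i j : Fin n =>
      if (i : ℕ) ≤ l i + (j : ℕ) then hsymm σ R (l i + (j : ℕ) - (i : ℕ)) else 0).det ∈
      idealOfVars τ R ^ (l i - (i : ℕ)) := by
  rw [← Matrix.det_transpose, Matrix.det_apply', map_sum]
  refine Ideal.sum_mem _ fun π _ => ?_
  rw [map_mul, map_prod]
  refine Ideal.mul_mem_left _ _ (Ideal.mem_of_dvd _ (Finset.dvd_prod_of_mem _ (Finset.mem_univ i)) ?_)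
  simp only [Matrix.transpose_apply, Matrix.of_apply]
  split_ifs with h
  · exact Ideal.pow_le_pow_right (by omega) (rename_hsymm_mem_pow_idealOfVars f _)
  · simp

theorem det_X_pow_ne_zero [IsDomain R] (n : ℕ) :
    (Matrix.of fun i j : Fin n => (X j : MvPolynomial (Fin n) R) ^ (n - 1 - (i : ℕ))).det ≠ 0 := by
  have h : (Matrix.of fun i j : Fin n => (X j : MvPolynomial (Fin n) R) ^ (n - 1 - (i : ℕ))) =
      (Matrix.projVandermonde (fun _ => 1) X).transpose := by
    ext1 i j
    simp only [Matrix.of_apply, Matrix.transpose_apply, Matrix.projVandermonde_apply, one_pow,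
      one_mul, Fin.val_rev]
    congr 1
    omega
  rw [h, Matrix.det_transpose, Matrix.det_projVandermonde]
  refine Finset.prod_ne_zero_iff.2 fun i _ => Finset.prod_ne_zero_iff.2 fun j hj => ?_
  rw [one_mul, one_mul, sub_ne_zero]
  exact fun e => (Finset.mem_Ioi.1 hj).ne (X_injective e)

end MvPolynomial

namespace MvPowerSeries

variable {n m : ℕ}

/-- The ring embedding of polynomials in the second block of variables into power series. -/
noncomputable def ofRight (n m : ℕ) :
    MvPolynomial (Fin m) ℚ →+* MvPowerSeries (Fin n ⊕ Fin m) ℚ :=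
  MvPolynomial.coeToMvPowerSeries.ringHom.comp (MvPolynomial.rename Sum.inr).toRingHom

/-- The ring embedding of polynomials in the first block of variables into power series. -/
noncomputable def ofLeft (n m : ℕ) :
    MvPolynomial (Fin n) ℚ →+* MvPowerSeries (Fin n ⊕ Fin m) ℚ :=
  MvPolynomial.coeToMvPowerSeries.ringHom.comp (MvPolynomial.rename Sum.inl).toRingHom

@[simp]
theorem ofRight_X (j : Fin m) : ofRight n m (MvPolynomial.X j) = X (Sum.inr j) := by
  simp [ofRight]

@[simp]
theorem ofLeft_X (i : Fin n) : ofLeft n m (MvPolynomial.X i) = X (Sum.inl i) := by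
  simp [ofLeft]

theorem ofLeft_injective : Function.Injective (ofLeft n m) :=
  (MvPolynomial.coe_injective _ _).comp (MvPolynomial.rename_injective _ Sum.inl_injective)

noncomputable instance (k : ℕ) : Fintype {p : Fin m → ℕ // ∑ j, p j = k} :=
  Fintype.ofEquiv _ (Sym.equivNatSumOfFintype (Fin m) k)

theorem ofRight_hsymm (k : ℕ) : ofRight n m (MvPolynomial.hsymm (Fin m) ℚ k) =
    ∑ p : {p : Fin m → ℕ // ∑ j, p j = k}, ∏ j, X (Sum.inr j) ^ p.1 j := by
  rw [MvPolynomial.hsymm, map_sum]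
  refine Fintype.sum_equiv (Sym.equivNatSumOfFintype (Fin m) k) _ _ fun s => ?_
  rw [map_multiset_prod, Multiset.map_map, Finset.prod_multiset_map_count]
  simp only [Function.comp_apply, ofRight_X, Sym.coe_equivNatSumOfFintype_apply_apply]
  refine Finset.prod_subset (Finset.subset_univ _) fun j _ hj => ?_
  rw [Multiset.count_eq_zero.2 (by simpa using hj), pow_zero]

/-- The generating function of the complete homogeneous symmetric polynomials. -/
theorem hasSum_hsymm_mul_pow {i : Fin n} {g : Fin m → MvPowerSeries (Fin n ⊕ Fin m) ℚ}
    (hg : ∀ j, HasSum (fun k : ℕ => (X (Sum.inl i) * X (Sum.inr j) :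
      MvPowerSeries (Fin n ⊕ Fin m) ℚ) ^ k) (g j)) :
    HasSum (fun k => ofRight n m (MvPolynomial.hsymm (Fin m) ℚ k) * X (Sum.inl i) ^ k)
      (∏ j, g j) := by
  have h := hasSum_prod_of_summable hg (summable_of_X_pow_dvd (e := Sum.inr) fun p j =>
    (pow_dvd_pow_of_dvd (dvd_mul_left _ _) _).trans (Finset.dvd_prod_of_mem
      (fun j => (X (Sum.inl i) * X (Sum.inr j) : MvPowerSeries (Fin n ⊕ Fin m) ℚ) ^ p j)
      (Finset.mem_univ j)))
  rw [← (Equiv.sigmaFiberEquiv fun p : Fin m → ℕ => ∑ j, p j).hasSum_iff] at h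
  refine h.sigma fun k => ?_
  convert hasSum_fintype _ using 1
  rw [ofRight_hsymm, Finset.sum_mul]
  refine Finset.sum_congr rfl fun p _ => ?_
  have hp : ∑ j, p.1 j = k := p.2
  simp only [Function.comp_apply, Equiv.sigmaFiberEquiv_apply, mul_pow, Finset.prod_mul_distrib,
    Finset.prod_pow_eq_pow_sum, hp]
  rw [mul_comm]

theorem hasSum_shift_hsymm_mul_pow {i : Fin n} {G : MvPowerSeries (Fin n ⊕ Fin m) ℚ}
    (hG : HasSum (fun k => ofRight n m (MvPolynomial.hsymm (Fin m) ℚ k) * X (Sum.inl i) ^ k) G)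
    (a : ℕ) :
    HasSum (fun k => (if a ≤ k then ofRight n m (MvPolynomial.hsymm (Fin m) ℚ (k - a)) else 0) *
      X (Sum.inl i) ^ k) (G * X (Sum.inl i) ^ a) := by
  rw [← (add_left_injective a).hasSum_iff]
  · refine (hG.mul_right (X (Sum.inl i) ^ a)).congr_fun fun k => ?_
    simp [pow_add, mul_assoc]
  · intro k hk
    rw [if_neg, zero_mul]
    exact fun h => hk ⟨k - a, Nat.sub_add_cancel h⟩

theorem summable_mul_det_hsymm (s : (Fin n → ℕ) → MvPowerSeries (Fin n ⊕ Fin m) ℚ) :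
    Summable fun l : {l : Fin n → ℕ // Antitone l} =>
      s l.1 * ofRight n m (Matrix.of fun i j : Fin n => if (i : ℕ) ≤ l.1 i + (j : ℕ) then
        MvPolynomial.hsymm (Fin m) ℚ (l.1 i + (j : ℕ) - (i : ℕ)) else 0).det := by
  refine summable_of_finite_coeff_ne_zero fun d => ?_
  refine ((Set.finite_Iic fun _ : Fin n => d.degree + n).preimage
    Subtype.val_injective.injOn).subset fun l hl i => ?_
  by_contra h
  have hi := i.2
  dsimp only at h
  refine hl (coeff_of_lt_order ?_)
  refine lt_of_lt_of_le ?_ ((le_add_left le_rfl).trans le_order_mul)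
  refine lt_of_lt_of_le (b := ((l.1 i - (i : ℕ) : ℕ) : ℕ∞)) (Nat.cast_lt.2 (by omega)) ?_
  refine nat_le_order fun e he => ?_
  have := MvPolynomial.rename_det_hsymm_mem_pow_idealOfVars (R := ℚ)
    (Sum.inr : Fin m → Fin n ⊕ Fin m) l.1 i
  exact (MvPolynomial.mem_pow_idealOfVars_iff' _ _).1 this e he

end MvPowerSeries

theorem stmt_5 (n m : ℕ)
    (s : (Fin n → ℕ) → MvPolynomial (Fin n) ℚ)
    (hs : ∀ lam : Fin n → ℕ, Antitone lam →
      s lam * (Matrix.of fun i j : Fin n =>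
          (MvPolynomial.X j : MvPolynomial (Fin n) ℚ) ^ (n - 1 - (i : ℕ))).det
        = (Matrix.of fun i j : Fin n =>
          (MvPolynomial.X j : MvPolynomial (Fin n) ℚ) ^ (lam i + (n - 1 - (i : ℕ)))).det)
    (g : Fin n → Fin m → MvPowerSeries (Fin n ⊕ Fin m) ℚ)
    (hg : ∀ (i : Fin n) (j : Fin m), HasSum
      (fun k : ℕ => (MvPowerSeries.X (Sum.inl i) * MvPowerSeries.X (Sum.inr j) :
        MvPowerSeries (Fin n ⊕ Fin m) ℚ) ^ k) (g i j)) :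
    HasSum
      (fun lam : {l : Fin n → ℕ // Antitone l} =>
        (MvPolynomial.coeToMvPowerSeries.ringHom
            (MvPolynomial.rename (Sum.inl : Fin n → Fin n ⊕ Fin m) (s lam.1)) :
          MvPowerSeries (Fin n ⊕ Fin m) ℚ) *
        (MvPolynomial.coeToMvPowerSeries.ringHom
            (MvPolynomial.rename (Sum.inr : Fin m → Fin n ⊕ Fin m)
              (Matrix.of fun i j : Fin n =>
                if (i : ℕ) ≤ lam.1 i + (j : ℕ) then
                  MvPolynomial.hsymm (Fin m) ℚ (lam.1 i + (j : ℕ) - (i : ℕ))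
                else 0).det) :
          MvPowerSeries (Fin n ⊕ Fin m) ℚ))
      (∏ i : Fin n, ∏ j : Fin m, g i j) := by
  have h_sum := MvPowerSeries.summable_mul_det_hsymm (m := m)
    fun l => MvPowerSeries.ofLeft n m (s l)
  have h_ne : MvPowerSeries.ofLeft n m (Matrix.of fun i j : Fin n =>
      (MvPolynomial.X j : MvPolynomial (Fin n) ℚ) ^ (n - 1 - (i : ℕ))).det ≠ 0 :=
    (map_ne_zero_iff _ MvPowerSeries.ofLeft_injective).2 (MvPolynomial.det_X_pow_ne_zero n)
  have h_entry (i j : Fin n) := MvPowerSeries.hasSum_shift_hsymm_mul_pow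
    (MvPowerSeries.hasSum_hsymm_mul_pow (hg j)) (n - 1 - (i : ℕ))
  have h_binet := hasSum_det_mul_det
    (c := fun i k => if n - 1 - (i : ℕ) ≤ k then
      MvPowerSeries.ofRight n m (MvPolynomial.hsymm (Fin m) ℚ (k - (n - 1 - (i : ℕ)))) else 0)
    (x := fun k j => MvPowerSeries.X (Sum.inl j) ^ k)
    (F := Matrix.of fun i j => (∏ j', g j j') * MvPowerSeries.X (Sum.inl j) ^ (n - 1 - (i : ℕ)))
    h_entry
    (fun σ => MvPowerSeries.summable_of_X_pow_dvd (e := Sum.inl) fun p j =>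
      (dvd_mul_left _ _).trans (Finset.dvd_prod_of_mem _ (Finset.mem_univ j)))
  have h_det : (Matrix.of fun i j : Fin n => (∏ j', g j j') *
      (MvPowerSeries.X (Sum.inl j) ^ (n - 1 - (i : ℕ)) :
        MvPowerSeries (Fin n ⊕ Fin m) ℚ)).det =
      MvPowerSeries.ofLeft n m (Matrix.of fun i j : Fin n =>
        (MvPolynomial.X j : MvPolynomial (Fin n) ℚ) ^ (n - 1 - (i : ℕ))).det *
      ∏ i, ∏ j, g i j := by
    rw [RingHom.map_det, mul_comm, ← Matrix.det_mul_row]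
    congr 1
    ext1 i j
    simp
  rw [h_det] at h_binet
  have h_mul := h_sum.hasSum.mul_left (MvPowerSeries.ofLeft n m (Matrix.of fun i j : Fin n =>
      (MvPolynomial.X j : MvPolynomial (Fin n) ℚ) ^ (n - 1 - (i : ℕ))).det)
  have h_eq := h_mul.unique (h_binet.congr_fun fun l => ?_)
  · rw [← mul_left_cancel₀ h_ne h_eq]
    exact h_sum.hasSum
  · rw [← mul_assoc, ← map_mul, mul_comm _ (s l.1), hs l.1 l.2, RingHom.map_det, RingHom.map_det]
    congr 2
    · ext1 i j
      simp
    · ext1 i j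
      simp only [RingHom.mapMatrix_apply, Matrix.map_apply, Matrix.of_apply, apply_ite
        (MvPowerSeries.ofRight n m), map_zero]
      have hi := i.2
      have hj := j.2
      refine if_congr (by omega) ?_ rfl
      congr 2
      omega
end

section
/- (Dual Cauchy identity) As an identity of polynomials in x_1,…,x_n and y_1,…,y_m: Σ_{λ ∈ 𝒫_n} s_λ(x) · s_{λ'}(y) = Π_{i=1}^n Π_{j=1}^m (1 + x_i y_j), where the sum is over all partitions λ of length at most n, λ' denotes the conjugate partition of λ, and s_{λ'}(y) is the Schur polynomial of λ' in the m variables y (it is 0 when λ' has more than m nonzero parts, i.e. when λ_1 > m). -/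
section

open Finset

/-- The **Cauchy–Binet formula**, indexing minors by strictly antitone column choices. -/
theorem Matrix.det_mul_eq_sum_strictAnti {R κ : Type*} [CommRing R] [Fintype κ] [LinearOrder κ]
    {n : ℕ} (A : Matrix (Fin n) κ R) (B : Matrix κ (Fin n) R)
    [DecidablePred (StrictAnti : (Fin n → κ) → Prop)] :
    (A * B).det = ∑ g : Fin n → κ with StrictAnti g,
      (A.submatrix id g).det * (B.submatrix g id).det := by
  classical
  have expand : (A * B).det
      = ∑ f : Fin n → κ, (∏ i, A i (f i)) * (B.submatrix f id).det := by
    have rows : A * B = fun i => ∑ p, A i p • B p := by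
      ext i j
      simp [Matrix.mul_apply]
    rw [rows]
    refine ((Matrix.detRowAlternating (n := Fin n) (R := R)).toMultilinearMap.map_sum _).trans ?_
    refine sum_congr rfl fun f _ => ?_
    exact (Matrix.detRowAlternating (n := Fin n) (R := R)).toMultilinearMap.map_smul_univ _ _
  have restrict : ∑ f : Fin n → κ, (∏ i, A i (f i)) * (B.submatrix f id).det
      = ∑ f : Fin n → κ with Function.Injective f,
        (∏ i, A i (f i)) * (B.submatrix f id).det := by
    refine (sum_filter_of_ne fun f _ hf => ?_).symm
    contrapose! hf
    obtain ⟨i, j, hij, hne⟩ := Function.not_injective_iff.mp hf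
    rw [Matrix.det_zero_of_row_eq hne (by ext k; simp [hij]), mul_zero]
  rw [expand, restrict]
  have minor (g : Fin n → κ) : (A.submatrix id g).det * (B.submatrix g id).det
      = ∑ σ : Equiv.Perm (Fin n),
        (∏ i, A i ((g ∘ σ) i)) * (B.submatrix (g ∘ σ) id).det := by
    rw [← Matrix.det_transpose, Matrix.det_apply', sum_mul]
    refine sum_congr rfl fun σ _ => ?_
    have := Matrix.det_permute σ (B.submatrix g id)
    rw [Matrix.submatrix_submatrix] at this
    rw [Function.comp_id] at this
    rw [this]
    simp only [Matrix.transpose_apply, Matrix.submatrix_apply, id, Function.comp]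
    ring
  simp_rw [minor]
  rw [← sum_product']
  symm
  refine sum_nbij (fun p => p.1 ∘ p.2) ?_ ?_ ?_ fun _ _ => rfl
  · rintro ⟨g, σ⟩ h
    simp only [mem_product, mem_filter, mem_univ, true_and, and_true] at h ⊢
    exact h.injective.comp σ.injective
  · rintro ⟨g, σ⟩ hg ⟨g', σ'⟩ hg' h
    simp only [coe_product, Set.mem_prod, mem_coe, mem_filter, mem_univ, true_and, and_true]
      at hg hg' h
    have hr : Set.range g = Set.range g' := by
      rw [← σ.surjective.range_comp g, h, σ'.surjective.range_comp]
    have hgg : g = g' := by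
      have := (StrictMono.range_inj hg.dual_right hg'.dual_right).mp (by
        simpa [Set.range_comp] using congrArg (Set.image OrderDual.toDual) hr)
      exact this
    subst hgg
    have : σ = σ' := Equiv.ext fun i => hg.injective (congrFun h i)
    rw [this]
  · intro f hf
    simp only [coe_filter, mem_univ, true_and, Set.mem_ofPred_eq] at hf
    let τ := Tuple.sort (OrderDual.toDual ∘ f)
    have hτ : Monotone ((OrderDual.toDual ∘ f) ∘ τ) := Tuple.monotone_sort _
    refine ⟨(f ∘ τ, τ.symm), ?_, ?_⟩
    · simp only [coe_product, Set.mem_prod, mem_coe, mem_filter, mem_univ, true_and, and_true]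
      exact fun i j hij => hτ.strictMono_of_injective
        ((OrderDual.toDual.injective.comp hf).comp τ.injective) hij
    · ext i
      simp

theorem MvPolynomial.esymm_eq_zero_of_card_lt (σ R : Type*) [CommSemiring R] [Fintype σ] {k : ℕ}
    (h : Fintype.card σ < k) : MvPolynomial.esymm σ R k = 0 := by
  rw [MvPolynomial.esymm, powersetCard_eq_empty.mpr (by simpa using h), sum_empty]

theorem MvPolynomial.prod_one_add_mul_eq_sum_esymm {σ R S : Type*} [CommSemiring R]
    [CommSemiring S] [Algebra R S] [Fintype σ] (z : S) (y : σ → S) :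
    ∏ l, (1 + z * y l)
      = ∑ k ∈ range (Fintype.card σ + 1), aeval y (MvPolynomial.esymm σ R k) * z ^ k := by
  rw [prod_one_add, sum_powerset, card_univ]
  refine sum_congr rfl fun k _ => ?_
  rw [MvPolynomial.aeval_esymm_eq_multiset_esymm, Finset.esymm_map_val, sum_mul]
  refine sum_congr rfl fun t ht => ?_
  rw [prod_mul_distrib, prod_const, (mem_powersetCard.mp ht).2, mul_comm]

/-- Multiplying a power of `z` by `∏ (1 + z * y l)`, as a row of shifted elementary symmetric
polynomials times a column of powers of `z`. -/
theorem MvPolynomial.sum_shifted_esymm_mul_pow {σ R S : Type*} [CommSemiring R]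
    [CommSemiring S] [Algebra R S] [Fintype σ] (z : S) (y : σ → S) {a N : ℕ}
    (h : a + Fintype.card σ < N) :
    ∑ p : Fin N, (if a ≤ (p : ℕ) then aeval y (MvPolynomial.esymm σ R (p - a)) else 0)
        * z ^ (p : ℕ)
      = z ^ a * ∏ l, (1 + z * y l) := by
  rw [Fin.sum_univ_eq_sum_range
    (fun p => (if a ≤ p then aeval y (MvPolynomial.esymm σ R (p - a)) else 0) * z ^ p),
    prod_one_add_mul_eq_sum_esymm (R := R)]
  obtain ⟨b, rfl⟩ := Nat.exists_eq_add_of_lt h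
  rw [show a + Fintype.card σ + b + 1 = a + (Fintype.card σ + 1 + b) by ring, sum_range_add,
    sum_range_add _ (Fintype.card σ + 1) b]
  rw [sum_eq_zero (s := range a), sum_eq_zero (s := range b), zero_add, add_zero, mul_sum]
  · refine sum_congr rfl fun k _ => ?_
    rw [if_pos (Nat.le_add_right _ _), Nat.add_sub_cancel_left, pow_add]
    ring
  · intro k _
    rw [if_pos (Nat.le_add_right _ _), Nat.add_sub_cancel_left,
      esymm_eq_zero_of_card_lt σ R (by omega), map_zero, zero_mul]
  · intro p hp
    rw [if_neg (by simpa using hp), zero_mul]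

theorem Matrix.det_pow_rev_ne_zero {R : Type*} [CommRing R] [IsDomain R] {n : ℕ} {v : Fin n → R}
    (hv : Function.Injective v) :
    (Matrix.of fun i j : Fin n => v j ^ (n - 1 - (i : ℕ))).det ≠ 0 := by
  have h : (Matrix.of fun i j : Fin n => v j ^ (n - 1 - (i : ℕ)))
      = (Matrix.vandermonde v).transpose.submatrix Fin.revPerm id := by
    ext i j
    simp [Matrix.vandermonde_apply, Fin.val_rev, Nat.sub_sub, add_comm]
  rw [h, Matrix.det_permute, Matrix.det_transpose]
  refine mul_ne_zero ?_ (Matrix.det_vandermonde_ne_zero_iff.mpr hv)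
  rcases Int.units_eq_one_or (Equiv.Perm.sign (Fin.revPerm : Equiv.Perm (Fin n))) with h | h <;>
    simp [h]

/-- A strictly antitone sequence in `Fin N` exceeds the staircase. -/
theorem Fin.staircase_le_of_strictAnti {n N : ℕ} {g : Fin n → Fin N} (hg : StrictAnti g)
    (i : Fin n) : n - 1 - (i : ℕ) ≤ g i := by
  obtain ⟨k, hk⟩ : ∃ k, n - 1 - (i : ℕ) = k := ⟨_, rfl⟩
  induction k generalizing i with
  | zero => omega
  | succ k ih =>
    have hi : (i : ℕ) + 1 < n := by omega
    have h1 := ih ⟨i + 1, hi⟩ (by simp only; omega)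
    have h2 : g ⟨i + 1, hi⟩ < g i := hg (by simp [Fin.lt_def])
    simp only [Fin.lt_def] at h1 h2
    omega

/-- Removing the staircase from a strictly antitone sequence leaves a partition. -/
theorem Fin.antitone_sub_staircase {n N : ℕ} {g : Fin n → Fin N} (hg : StrictAnti g) :
    Antitone fun i => (g i : ℕ) - (n - 1 - (i : ℕ)) := by
  rcases n with _ | n
  · exact fun i => i.elim0
  refine Fin.antitone_iff_succ_le.mpr fun i => ?_
  have h1 := staircase_le_of_strictAnti hg i.succ
  have h2 : g i.succ < g i.castSucc := hg Fin.castSucc_lt_succ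
  have := i.isLt
  simp only [Fin.lt_def, Fin.val_succ, Fin.val_castSucc] at *
  omega

end

/-!
STATEMENT 6 (Dual Cauchy identity): As polynomials in `x_1,…,x_n` and `y_1,…,y_m`:
`Σ_{λ ∈ 𝒫_n} s_λ(x) · s_{λ'}(y) = Π_{i=1}^n Π_{j=1}^m (1 + x_i y_j)`.
We work in `MvPolynomial (Fin n ⊕ Fin m) ℚ` with `x_i = X (inl i)`, `y_j = X (inr j)`.
`s_λ(x)` is the unique polynomial with `s λ * det(x_j^{n-i}) = det(x_j^{λ_i+n-i})`
(bialternant formula), and `s_{λ'}(y)` is given, per the dual Jacobi–Trudi identity,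
by `det(e_{λ_i-i+j}(y))` (with `e_k = 0` for `k < 0`; it is `0` when `λ_1 > m`).
The sum over all partitions, with finitely many nonzero terms, is a `finsum`.
-/

theorem stmt_6 (n m : ℕ)
    (s : (Fin n → ℕ) → MvPolynomial (Fin n) ℚ)
    (hs : ∀ lam : Fin n → ℕ, Antitone lam →
      s lam * (Matrix.of fun i j : Fin n =>
          (MvPolynomial.X j : MvPolynomial (Fin n) ℚ) ^ (n - 1 - (i : ℕ))).det
        = (Matrix.of fun i j : Fin n =>
          (MvPolynomial.X j : MvPolynomial (Fin n) ℚ) ^ (lam i + (n - 1 - (i : ℕ)))).det) :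
    ∑ᶠ lam : {l : Fin n → ℕ // Antitone l},
      MvPolynomial.rename (Sum.inl : Fin n → Fin n ⊕ Fin m) (s lam.1) *
        MvPolynomial.rename (Sum.inr : Fin m → Fin n ⊕ Fin m)
          (Matrix.of fun i j : Fin n =>
            if (i : ℕ) ≤ lam.1 i + (j : ℕ) then
              MvPolynomial.esymm (Fin m) ℚ (lam.1 i + (j : ℕ) - (i : ℕ))
            else 0).det
    = ∏ i : Fin n, ∏ j : Fin m,
        (1 + MvPolynomial.X (Sum.inl i) * MvPolynomial.X (Sum.inr j) :
          MvPolynomial (Fin n ⊕ Fin m) ℚ) := by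
  classical
  set S := MvPolynomial (Fin n ⊕ Fin m) ℚ
  set x : Fin n → S := fun j => MvPolynomial.X (Sum.inl j) with hx
  set y : Fin m → S := fun l => MvPolynomial.X (Sum.inr l)
  set F : {l : Fin n → ℕ // Antitone l} → S := fun lam =>
      MvPolynomial.rename (Sum.inl : Fin n → Fin n ⊕ Fin m) (s lam.1) *
        MvPolynomial.rename (Sum.inr : Fin m → Fin n ⊕ Fin m)
          (Matrix.of fun i j : Fin n =>
            if (i : ℕ) ≤ lam.1 i + (j : ℕ) then
              MvPolynomial.esymm (Fin m) ℚ (lam.1 i + (j : ℕ) - (i : ℕ))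
            else 0).det with hF
  set D : S := (Matrix.of fun i j : Fin n => x j ^ (n - 1 - (i : ℕ))).det with hD
  have hD0 : D ≠ 0 := Matrix.det_pow_rev_ne_zero
    ((MvPolynomial.X_injective).comp Sum.inl_injective)
  have rename_det (f : Fin n → ℕ) :
      MvPolynomial.rename (Sum.inl : Fin n → Fin n ⊕ Fin m) (Matrix.of fun i j : Fin n =>
          (MvPolynomial.X j : MvPolynomial (Fin n) ℚ) ^ f i).det
        = (Matrix.of fun i j : Fin n => x j ^ f i).det := by
    rw [AlgHom.map_det]
    congr 1
    refine Matrix.ext fun i j => ?_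
    simp [hx]
  let C : Matrix (Fin n) (Fin (n + m)) S := Matrix.of fun i p =>
    if n - 1 - (i : ℕ) ≤ p then
      MvPolynomial.aeval y (MvPolynomial.esymm (Fin m) ℚ (p - (n - 1 - i)))
    else 0
  let V : Matrix (Fin (n + m)) (Fin n) S := Matrix.of fun p j => x j ^ (p : ℕ)
  have hCV : (C * V).det = D * ∏ i, ∏ l, (1 + x i * y l) := by
    rw [mul_comm, hD, ← Matrix.det_mul_row]
    congr 1
    refine Matrix.ext fun i j => ?_
    simp only [Matrix.mul_apply, C, V, Matrix.of_apply]
    rw [MvPolynomial.sum_shifted_esymm_mul_pow _ _ (by rw [Fintype.card_fin]; omega), mul_comm]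
  let L : {g : Fin n → Fin (n + m) // StrictAnti g} → {l : Fin n → ℕ // Antitone l} := fun g =>
    ⟨_, Fin.antitone_sub_staircase g.2⟩
  have hL : Function.Injective L := by
    intro g g' h
    ext i
    have h1 := Fin.staircase_le_of_strictAnti g.2 i
    have h2 := Fin.staircase_le_of_strictAnti g'.2 i
    have h3 : (g.1 i : ℕ) - (n - 1 - (i : ℕ)) = g'.1 i - (n - 1 - (i : ℕ)) :=
      congrFun (congrArg Subtype.val h) i
    omega
  have hterm (g : {g : Fin n → Fin (n + m) // StrictAnti g}) :
      (C.submatrix id g.1).det * (V.submatrix g.1 id).det = D * F (L g) := by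
    have key := congrArg (MvPolynomial.rename (Sum.inl : Fin n → Fin n ⊕ Fin m))
      (hs (L g).1 (L g).2)
    rw [map_mul, rename_det, rename_det] at key
    have hV : V.submatrix g.1 id
        = Matrix.of fun i j : Fin n => x j ^ ((L g).1 i + (n - 1 - (i : ℕ))) := by
      refine Matrix.ext fun i j => ?_
      simp only [V, L, Matrix.submatrix_apply, Matrix.of_apply, id]
      rw [Nat.sub_add_cancel (Fin.staircase_le_of_strictAnti g.2 i)]
    have hC : (C.submatrix id g.1).det = MvPolynomial.rename (Sum.inr : Fin m → Fin n ⊕ Fin m)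
          (Matrix.of fun i j : Fin n =>
            if (i : ℕ) ≤ (L g).1 i + (j : ℕ) then
              MvPolynomial.esymm (Fin m) ℚ ((L g).1 i + (j : ℕ) - (i : ℕ))
            else 0).det := by
      rw [AlgHom.map_det, ← Matrix.det_transpose]
      congr 1
      refine Matrix.ext fun i j => ?_
      have h1 := Fin.staircase_le_of_strictAnti g.2 i
      simp only [C, L, Matrix.submatrix_apply, Matrix.transpose_apply, Matrix.of_apply, id,
        AlgHom.mapMatrix_apply, Matrix.map_apply]
      rw [apply_ite (MvPolynomial.rename _), map_zero]
      have h2 : n - 1 - (j : ℕ) ≤ g.1 i ↔ (i : ℕ) ≤ g.1 i - (n - 1 - (i : ℕ)) + j := by omega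
      refine if_congr h2 ?_ rfl
      rw [show (g.1 i : ℕ) - (n - 1 - j) = g.1 i - (n - 1 - (i : ℕ)) + j - i by omega]
      exact DFunLike.congr_fun (MvPolynomial.algHom_ext fun l =>
        (MvPolynomial.aeval_X _ l).trans (MvPolynomial.rename_X _ l).symm) _
    rw [hC, hV, ← key]
    simp only [hF]
    ring
  have hsupp : Function.support F ⊆ ↑(Finset.univ.image L) := by
    intro lam hlam
    have hbound (i : Fin n) : lam.1 i ≤ m := by
      by_contra! hi
      refine hlam ?_
      have hn : 0 < n := i.pos
      have h0 : m < lam.1 ⟨0, hn⟩ := hi.trans_le (lam.2 (Fin.mk_le_of_le_val (Nat.zero_le _)))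
      simp only [hF]
      rw [Matrix.det_eq_zero_of_row_eq_zero ⟨0, hn⟩, map_zero, mul_zero]
      intro j
      rw [Matrix.of_apply, if_pos (Nat.zero_le _),
        MvPolynomial.esymm_eq_zero_of_card_lt _ _ (by simp only [Fintype.card_fin]; omega)]
    simp only [Finset.coe_image, Finset.coe_univ, Set.image_univ, Set.mem_range]
    refine ⟨⟨fun i => ⟨lam.1 i + (n - 1 - i), by have := hbound i; omega⟩, fun i j hij => ?_⟩, ?_⟩
    · have := lam.2 hij.le
      simp only [Fin.lt_def] at hij ⊢
      omega
    · ext i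
      simp [L]
  rw [finsum_eq_sum_of_support_subset F hsupp, Finset.sum_image hL.injOn]
  refine mul_left_cancel₀ hD0 ?_
  rw [← hCV, Matrix.det_mul_eq_sum_strictAnti, Finset.mul_sum, ← Finset.sum_subtype_eq_sum_filter]
  simp only [← hterm]
  rw [Finset.subtype_univ]
end

section
/- Let a be a nonnegative integer, f_0, f_1, …, f_a polynomials in y = (y_1,…,y_m), and F(y, z, a) = Σ_{k=0}^{a} f_k z^k. Then Σ_{λ ∈ 𝒫_n, λ ≤ (a,a,…,a)} s_λ(x) · det(f̃_{λ_i − i + j})_{1 ≤ i,j ≤ n} = Π_{i=1}^n F(y, x_i, a), where the sum runs over partitions λ of length at most n with λ_1 ≤ a, and the (i,j)-entry f̃_{λ_i − i + j} equals f_{λ_i − i + j} if 0 ≤ λ_i − i + j ≤ a and 0 otherwise. -/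
/-!
STATEMENT 12 (bounded identity with equal bounds): For a nonnegative integer `a`,
polynomials `f_0,…,f_a` in `y_1,…,y_m`, and `F(y,z,a) = Σ_{k=0}^{a} f_k z^k`:
`Σ_{λ ∈ 𝒫_n, λ ≤ (a,…,a)} s_λ(x) · det(f̃_{λ_i-i+j}) = Π_{i=1}^n F(y, x_i, a)`,
where `f̃_{λ_i-i+j} = f_{λ_i-i+j}` if `0 ≤ λ_i-i+j ≤ a` and `0` otherwise.
We work in `MvPolynomial (Fin n ⊕ Fin m) ℚ` with `x_i = X (inl i)`, `y = X ∘ inr`;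
the Schur polynomial `s λ` is the unique polynomial with
`s λ * det(x_j^{n-i}) = det(x_j^{λ_i+n-i})` (bialternant formula).
-/

namespace Matrix

variable {R κ : Type*} [CommRing R] {n : ℕ}

theorem det_mul_eq_sum_prod_mul_det_submatrix [Fintype κ]
    (A : Matrix (Fin n) κ R) (B : Matrix κ (Fin n) R) :
    (A * B).det = ∑ g : Fin n → κ, (∏ i, A i (g i)) * (B.submatrix g id).det := by
  classical
  have h : A * B = fun i => ∑ k, A i k • B k := by
    ext i j
    simp [Matrix.mul_apply]
  have h₂ := (detRowAlternating (R := R) (n := Fin n)).toMultilinearMap.map_sum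
    (fun i k => A i k • B k)
  rw [h]
  refine h₂.trans (Finset.sum_congr rfl fun g _ => ?_)
  exact (detRowAlternating (R := R) (n := Fin n)).toMultilinearMap.map_smul_univ _ _

theorem exists_strictAnti_comp_perm [LinearOrder κ] {g : Fin n → κ}
    (hg : Function.Injective g) :
    ∃ (p : Fin n → κ) (σ : Equiv.Perm (Fin n)), StrictAnti p ∧ p ∘ σ = g := by
  let d : Fin n → κᵒᵈ := OrderDual.toDual ∘ g
  let τ := Tuple.sort d
  have hinj : Function.Injective (g ∘ τ) := hg.comp τ.injective
  have hanti : Antitone (g ∘ τ) := fun i j hij => Tuple.monotone_sort d hij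
  refine ⟨g ∘ τ, τ⁻¹, hanti.strictAnti_of_injective hinj, ?_⟩
  ext i
  simp

/-- The **Cauchy–Binet formula**, with the square minors indexed by strictly decreasing tuples. -/
theorem det_mul_eq_sum_strictAnti_s12 [Fintype κ] [LinearOrder κ]
    (A : Matrix (Fin n) κ R) (B : Matrix κ (Fin n) R)
    [DecidablePred (StrictAnti : (Fin n → κ) → Prop)] :
    (A * B).det = ∑ p : Fin n → κ with StrictAnti p,
      (A.submatrix id p).det * (B.submatrix p id).det := by
  classical
  rw [det_mul_eq_sum_prod_mul_det_submatrix]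
  have hzero : ∀ g : Fin n → κ, ¬ Function.Injective g → (B.submatrix g id).det = 0 := by
    intro g hg
    obtain ⟨i, j, hij, hne⟩ : ∃ i j, g i = g j ∧ i ≠ j := by
      simpa [Function.Injective] using hg
    exact det_zero_of_row_eq hne (by ext k; simp [hij])
  rw [← Finset.sum_filter_of_ne (p := Function.Injective)
    (fun g _ h => by by_contra hg; exact h (by rw [hzero g hg, mul_zero]))]
  have hexp : ∀ p : Fin n → κ, (A.submatrix id p).det * (B.submatrix p id).det =
      ∑ σ : Equiv.Perm (Fin n), (∏ i, A i (p (σ i))) * (B.submatrix (p ∘ σ) id).det := by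
    intro p
    rw [← det_transpose, det_apply', Finset.sum_mul]
    refine Finset.sum_congr rfl fun σ _ => ?_
    have hσ : B.submatrix (p ∘ σ) id = (B.submatrix p id).submatrix σ id := rfl
    rw [hσ, det_permute]
    simp only [transpose_apply, submatrix_apply, id]
    ring
  simp_rw [hexp]
  rw [← Finset.sum_product']
  symm
  refine Finset.sum_bij (fun q _ => q.1 ∘ q.2) ?_ ?_ ?_ ?_
  · rintro ⟨p, σ⟩ h
    simp only [Finset.mem_product, Finset.mem_filter, Finset.mem_univ, true_and, and_true] at h ⊢
    exact h.injective.comp σ.injective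
  · rintro ⟨p, σ⟩ h ⟨p', σ'⟩ h' heq
    simp only [Finset.mem_product, Finset.mem_filter, Finset.mem_univ, true_and, and_true]
      at h h' heq
    have hp' : p ∘ (σ * σ'⁻¹ : Equiv.Perm (Fin n)) = p' := by
      ext i
      simpa using congrFun heq (σ'⁻¹ i)
    have hpp : p = p' := by
      rw [← hp']
      exact Tuple.unique_antitone (f := p) (σ := 1) h.antitone (by rw [hp']; exact h'.antitone)
    subst hpp
    refine Prod.ext rfl (Equiv.ext fun i => h.injective (congrFun heq i))
  · intro g hg
    obtain ⟨p, σ, hp, hpσ⟩ := exists_strictAnti_comp_perm (Finset.mem_filter.1 hg).2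
    exact ⟨(p, σ), by simpa using hp, hpσ⟩
  · rintro ⟨p, σ⟩ _
    rfl

theorem det_reversed_vandermonde_ne_zero [IsDomain R] {x : Fin n → R}
    (hx : Function.Injective x) :
    (Matrix.of fun i j : Fin n => x j ^ (n - 1 - (i : ℕ))).det ≠ 0 := by
  have h : (Matrix.of fun i j : Fin n => x j ^ (n - 1 - (i : ℕ)))
      = (vandermonde x)ᵀ.submatrix Fin.revPerm id := by
    ext i j
    simp only [of_apply, submatrix_apply, transpose_apply, vandermonde_apply, id,
      Fin.revPerm_apply, Fin.val_rev]
    congr 1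
    omega
  rw [h, det_permute, det_transpose]
  refine mul_ne_zero ?_ (det_vandermonde_ne_zero_iff.2 hx)
  rcases Int.units_eq_one_or (Equiv.Perm.sign (Fin.revPerm : Equiv.Perm (Fin n))) with h | h <;>
    simp [h]

end Matrix

theorem add_sub_le_of_strictAnti {n : ℕ} {p : Fin n → ℕ} (hp : StrictAnti p) {i j : Fin n}
    (hij : i ≤ j) : p j + ((j : ℕ) - i) ≤ p i := by
  obtain ⟨j, hj⟩ := j
  induction j with
  | zero => simp [show i = ⟨0, hj⟩ from le_antisymm hij (Nat.zero_le _)]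
  | succ j ih =>
    rcases hij.eq_or_lt with rfl | h
    · simp
    · have hlt : (i : ℕ) < j + 1 := h
      have h₁ := ih (by omega) (Fin.le_def.2 (Nat.lt_succ_iff.1 hlt))
      have h₂ : p ⟨j + 1, hj⟩ < p ⟨j, by omega⟩ := hp (Fin.lt_def.2 (Nat.lt_succ_self j))
      simp only at h₁ ⊢
      omega

/-- Adding the staircase `(n - 1, …, 1, 0)` identifies partitions inside the `n × a` box with
strictly decreasing tuples bounded by `n + a`. -/
theorem sum_antitone_box_eq_sum_strictAnti {M : Type*} [AddCommMonoid M] (n a : ℕ)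
    [DecidablePred (Antitone : (Fin n → ℕ) → Prop)]
    [DecidablePred (StrictAnti : (Fin n → Fin (n + a)) → Prop)] (φ : (Fin n → ℕ) → M) :
    ∑ lam ∈ Fintype.piFinset (fun _ : Fin n => Finset.range (a + 1)) with Antitone lam,
        φ (fun i => lam i + (n - 1 - (i : ℕ)))
      = ∑ p : Fin n → Fin (n + a) with StrictAnti p, φ (fun i => (p i : ℕ)) := by
  have hlast : ∀ p : Fin n → Fin (n + a), StrictAnti p → ∀ i : Fin n,
      n - 1 - (i : ℕ) ≤ p i := by
    intro p hp i
    have := add_sub_le_of_strictAnti (p := fun i => (p i : ℕ)) (fun _ _ h => hp h)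
      (i := i) (j := ⟨n - 1, Nat.sub_lt i.pos one_pos⟩) (Fin.le_def.2 (by simp only; omega))
    simp only at this
    omega
  have hbound : ∀ lam : Fin n → ℕ, lam ∈ (Fintype.piFinset
      (fun _ : Fin n => Finset.range (a + 1))).filter Antitone →
      ∀ i, lam i + (n - 1 - (i : ℕ)) < n + a := by
    intro lam h i
    have := Finset.mem_range.1 (Fintype.mem_piFinset.1 (Finset.mem_filter.1 h).1 i)
    omega
  refine Finset.sum_bij' (fun lam h i => ⟨lam i + (n - 1 - (i : ℕ)), hbound lam h i⟩)
    (fun p _ i => (p i : ℕ) - (n - 1 - (i : ℕ))) ?_ ?_ ?_ ?_ ?_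
  · intro lam h
    refine Finset.mem_filter.2 ⟨Finset.mem_univ _, fun i j hij => Fin.lt_def.2 ?_⟩
    have h₁ := (Finset.mem_filter.1 h).2 hij.le
    have h₂ := Fin.lt_def.1 hij
    simp only
    omega
  · intro p h
    have hp := (Finset.mem_filter.1 h).2
    refine Finset.mem_filter.2 ⟨Fintype.mem_piFinset.2 fun i => Finset.mem_range.2 ?_,
      fun i j hij => ?_⟩
    · have h₁ := add_sub_le_of_strictAnti (p := fun i => (p i : ℕ)) (fun _ _ h => hp h)
        (i := ⟨0, i.pos⟩) (j := i) (Fin.le_def.2 (Nat.zero_le _))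
      have h₂ := (p ⟨0, i.pos⟩).isLt
      simp only at h₁
      omega
    · have h₁ := add_sub_le_of_strictAnti (p := fun i => (p i : ℕ)) (fun _ _ h => hp h) hij
      have h₂ := Fin.le_def.1 hij
      have h₃ := hlast p hp j
      simp only at h₁ ⊢
      omega
  · intro lam h
    ext i
    simp
  · intro p h
    ext i
    have := hlast p (Finset.mem_filter.1 h).2 i
    simp only
    omega
  · intro lam h
    rfl

theorem prod_sum_mul_det_eq_sum_det_mul_det {R : Type*} [CommRing R] (n a : ℕ)
    [DecidablePred (Antitone : (Fin n → ℕ) → Prop)] (c : ℕ → R) (x : Fin n → R) :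
    (∏ i, ∑ k ∈ Finset.range (a + 1), c k * x i ^ k) *
        (Matrix.of fun i j : Fin n => x j ^ (n - 1 - (i : ℕ))).det
      = ∑ lam ∈ Fintype.piFinset (fun _ : Fin n => Finset.range (a + 1)) with Antitone lam,
        (Matrix.of fun i j : Fin n =>
          if (i : ℕ) ≤ lam i + (j : ℕ) ∧ lam i + (j : ℕ) - (i : ℕ) ≤ a then
            c (lam i + (j : ℕ) - (i : ℕ))
          else 0).det *
        (Matrix.of fun i j : Fin n => x j ^ (lam i + (n - 1 - (i : ℕ)))).det := by
  classical
  let A : Matrix (Fin n) (Fin (n + a)) R := Matrix.of fun i p =>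
    if n - 1 - (i : ℕ) ≤ p ∧ (p : ℕ) - (n - 1 - (i : ℕ)) ≤ a then
      c ((p : ℕ) - (n - 1 - (i : ℕ))) else 0
  let B : Matrix (Fin (n + a)) (Fin n) R := Matrix.of fun p j => x j ^ (p : ℕ)
  have hAB : A * B = Matrix.of fun i j : Fin n =>
      (∑ k ∈ Finset.range (a + 1), c k * x j ^ k) * x j ^ (n - 1 - (i : ℕ)) := by
    ext i j
    simp only [A, B, Matrix.mul_apply, Matrix.of_apply, ite_mul, zero_mul, Finset.sum_mul]
    rw [Fin.sum_univ_eq_sum_range (fun p => if n - 1 - (i : ℕ) ≤ p ∧ p - (n - 1 - (i : ℕ)) ≤ a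
      then c (p - (n - 1 - (i : ℕ))) * x j ^ p else 0), ← Finset.sum_filter]
    refine Finset.sum_bij' (fun p _ => p - (n - 1 - (i : ℕ))) (fun k _ => k + (n - 1 - (i : ℕ)))
      ?_ ?_ ?_ ?_ ?_
    · intro p hp
      simp only [Finset.mem_filter, Finset.mem_range] at hp ⊢
      omega
    · intro k hk
      simp only [Finset.mem_filter, Finset.mem_range] at hk ⊢
      omega
    · intro p hp
      simp only [Finset.mem_filter, Finset.mem_range] at hp ⊢
      omega
    · intro k hk
      simp
    · intro p hp
      simp only [Finset.mem_filter, Finset.mem_range] at hp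
      rw [mul_assoc, ← pow_add, Nat.sub_add_cancel hp.2.1]
  have hdet := Matrix.det_mul_row (fun j => ∑ k ∈ Finset.range (a + 1), c k * x j ^ k)
    (Matrix.of fun i j : Fin n => x j ^ (n - 1 - (i : ℕ)))
  simp only [Matrix.of_apply] at hdet
  rw [← hdet, ← hAB, Matrix.det_mul_eq_sum_strictAnti_s12]
  refine ((sum_antitone_box_eq_sum_strictAnti n a fun p : Fin n → ℕ =>
    (Matrix.of fun i l : Fin n =>
      if n - 1 - (i : ℕ) ≤ p l ∧ p l - (n - 1 - (i : ℕ)) ≤ a then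
        c (p l - (n - 1 - (i : ℕ))) else 0).det *
      (Matrix.of fun i j : Fin n => x j ^ p i).det).symm).trans ?_
  refine Finset.sum_congr rfl fun lam _ => ?_
  congr 1
  rw [← Matrix.det_transpose]
  congr 1
  ext i j
  simp only [Matrix.transpose_apply, Matrix.of_apply]
  rw [show lam i + (n - 1 - (i : ℕ)) - (n - 1 - (j : ℕ)) = lam i + j - i by omega]
  refine if_congr ?_ rfl rfl
  omega

theorem stmt_12 (n m a : ℕ)
    (f : ℕ → MvPolynomial (Fin m) ℚ)
    (s : (Fin n → ℕ) → MvPolynomial (Fin n) ℚ)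
    (hs : ∀ lam : Fin n → ℕ, Antitone lam →
      s lam * (Matrix.of fun i j : Fin n =>
          (MvPolynomial.X j : MvPolynomial (Fin n) ℚ) ^ (n - 1 - (i : ℕ))).det
        = (Matrix.of fun i j : Fin n =>
          (MvPolynomial.X j : MvPolynomial (Fin n) ℚ) ^ (lam i + (n - 1 - (i : ℕ)))).det) :
    ∑ᶠ (lam : Fin n → ℕ) (_ : Antitone lam ∧ ∀ i : Fin n, lam i ≤ a),
        MvPolynomial.rename (Sum.inl : Fin n → Fin n ⊕ Fin m) (s lam) *
          MvPolynomial.rename (Sum.inr : Fin m → Fin n ⊕ Fin m)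
            (Matrix.of fun i j : Fin n =>
              if (i : ℕ) ≤ lam i + (j : ℕ) ∧ lam i + (j : ℕ) - (i : ℕ) ≤ a then
                f (lam i + (j : ℕ) - (i : ℕ))
              else 0).det
    = ∏ i : Fin n, ∑ k ∈ Finset.range (a + 1),
        MvPolynomial.rename (Sum.inr : Fin m → Fin n ⊕ Fin m) (f k) *
          MvPolynomial.X (Sum.inl i) ^ k := by
  classical
  let x : Fin n → MvPolynomial (Fin n ⊕ Fin m) ℚ := fun i => MvPolynomial.X (Sum.inl i)
  have hx : Function.Injective x := (MvPolynomial.X_injective).comp Sum.inl_injective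
  rw [finsum_cond_eq_sum_of_cond_iff
    (t := (Fintype.piFinset (fun _ : Fin n => Finset.range (a + 1))).filter Antitone) _
    (fun _ => by simp [and_comm])]
  refine mul_right_cancel₀ (Matrix.det_reversed_vandermonde_ne_zero hx) ?_
  rw [prod_sum_mul_det_eq_sum_det_mul_det n a
    (fun k => MvPolynomial.rename (Sum.inr : Fin m → Fin n ⊕ Fin m) (f k)) x, Finset.sum_mul]
  refine Finset.sum_congr rfl fun lam hlam => ?_
  have hs' := congrArg (MvPolynomial.rename (Sum.inl : Fin n → Fin n ⊕ Fin m))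
    (hs lam (Finset.mem_filter.1 hlam).2)
  have hpow : ∀ e : Fin n → ℕ, MvPolynomial.rename (Sum.inl : Fin n → Fin n ⊕ Fin m)
      (Matrix.of fun i j : Fin n => (MvPolynomial.X j : MvPolynomial (Fin n) ℚ) ^ e i).det
      = (Matrix.of fun i j : Fin n => x j ^ e i).det := by
    intro e
    rw [AlgHom.map_det]
    congr 1
    ext1 i j
    simp [x]
  rw [map_mul, hpow (fun i => n - 1 - (i : ℕ)), hpow (fun i => lam i + (n - 1 - (i : ℕ)))] at hs'
  rw [mul_right_comm, hs', mul_comm, AlgHom.map_det]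
  congr 2
  ext1 i j
  simp [apply_ite (MvPolynomial.rename (Sum.inr : Fin m → Fin n ⊕ Fin m))]
end

section
/- Let a be a nonnegative integer. For a partition λ of length at most n with λ_1 ≤ a, define the n×n 0–1 matrix c(λ,a) by c_{ij}(λ,a) = 0 if λ_i + j − i < 0 or λ_i + j − i > a, and c_{ij}(λ,a) = 1 otherwise. Then Σ_{λ ∈ 𝒫_n, λ ≤ (a,a,…,a)} s_λ(x) · det(c(λ,a)) = Π_{i=1}^n (1 − x_i^{a+1})/(1 − x_i), where (1 − x_i^{a+1})/(1 − x_i) denotes the polynomial 1 + x_i + ⋯ + x_i^a. -/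
open Finset

/-- Expansion of the determinant of a product by multilinearity in the rows. -/
theorem Matrix.det_mul_eq_sum_fun {ι m R : Type*} [Fintype ι] [DecidableEq ι] [Fintype m]
    [CommRing R] (A : Matrix ι m R) (B : Matrix m ι R) :
    (A * B).det = ∑ f : ι → m, (∏ i, A i (f i)) * (B.submatrix f id).det := by
  classical
  have h : A * B = fun i => ∑ k, A i k • B k := by
    ext i j
    simp [Matrix.mul_apply, Finset.sum_apply]
  rw [h]
  refine ((Matrix.detRowAlternating (R := R) (n := ι)).toMultilinearMap.map_sum
    (fun i k => A i k • B k)).trans (Finset.sum_congr rfl fun f _ => ?_)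
  exact (Matrix.detRowAlternating (R := R) (n := ι)).toMultilinearMap.map_smul_univ
    (fun i => A i (f i)) (fun i => B (f i))

/-- The Cauchy–Binet formula. -/
theorem Matrix.det_mul_eq_sum_strictMono {n : ℕ} {m R : Type*} [Fintype m] [LinearOrder m]
    [CommRing R] (A : Matrix (Fin n) m R) (B : Matrix m (Fin n) R) :
    (A * B).det = ∑ g : Fin n → m with StrictMono g,
      (A.submatrix id g).det * (B.submatrix g id).det := by
  classical
  have hterm (g : Fin n → m) : (A.submatrix id g).det * (B.submatrix g id).det =
      ∑ σ : Equiv.Perm (Fin n), (∏ i, A i (g (σ i))) * (B.submatrix (g ∘ σ) id).det := by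
    rw [← Matrix.det_transpose, Matrix.det_apply', Finset.sum_mul]
    refine Finset.sum_congr rfl fun σ _ => ?_
    have h := Matrix.det_permute σ (B.submatrix g id)
    rw [Matrix.submatrix_submatrix] at h
    simp only [Function.id_comp] at h
    rw [h]
    simp only [Matrix.transpose_apply, Matrix.submatrix_apply, id]
    ring
  simp_rw [hterm]
  rw [Matrix.det_mul_eq_sum_fun, ← Finset.sum_product',
    ← Finset.sum_filter_of_ne (p := Function.Injective)]
  · symm
    refine Finset.sum_bij (fun p _ => p.1 ∘ p.2) ?_ ?_ ?_ ?_
    · rintro ⟨g, σ⟩ h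
      simp only [mem_product, mem_filter, mem_univ, true_and, and_true] at h ⊢
      exact h.injective.comp σ.injective
    · rintro ⟨g, σ⟩ h ⟨g', σ'⟩ h' heq
      simp only [mem_product, mem_filter, mem_univ, true_and, and_true] at h h' heq
      have hg : g = g' := by
        refine (h.range_inj h').1 ?_
        rw [← σ.surjective.range_comp g, heq, σ'.surjective.range_comp]
      subst hg
      simpa using Equiv.ext fun i => h.injective (congrFun heq i)
    · intro f hf
      simp only [mem_filter, mem_univ, true_and] at hf
      refine ⟨(f ∘ Tuple.sort f, (Tuple.sort f)⁻¹), ?_, ?_⟩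
      · simp only [mem_product, mem_filter, mem_univ, true_and, and_true]
        exact (Tuple.monotone_sort f).strictMono_of_injective (hf.comp (Equiv.injective _))
      · ext i
        simp
    · rintro ⟨g, σ⟩ h
      rfl
  · intro f _ hf
    by_contra hinj
    obtain ⟨i, j, hij, hne⟩ := Function.not_injective_iff.1 hinj
    refine hf ?_
    rw [Matrix.det_zero_of_row_eq hne (by ext k; simp [hij]), mul_zero]

theorem StrictAnti.add_val_antitone {n : ℕ} {f : Fin n → ℕ} (hf : StrictAnti f) :
    Antitone fun i : Fin n => f i + (i : ℕ) := by
  cases n with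
  | zero => exact fun i => i.elim0
  | succ n =>
    refine Fin.antitone_iff_succ_le.2 fun i => ?_
    have := hf (Fin.castSucc_lt_succ (i := i))
    simp only [Fin.val_succ, Fin.val_castSucc]
    omega

/-- Partitions in an `n × a` box correspond to strictly decreasing `n`-tuples below `n + a`. -/
theorem sum_antitone_eq_sum_strictMono {M : Type*} [AddCommMonoid M] (n a : ℕ)
    (F : (Fin n → ℕ) → M) :
    ∑ lam ∈ Fintype.piFinset (fun _ : Fin n => range (a + 1)) with Antitone lam,
        F (fun i => lam i + (n - 1 - (i : ℕ))) =
      ∑ g : Fin n → (Fin (n + a))ᵒᵈ with StrictMono g,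
        F (fun i => (OrderDual.ofDual (g i)).val) := by
  classical
  have hanti (g : Fin n → (Fin (n + a))ᵒᵈ) (hg : StrictMono g) :
      StrictAnti fun i => (OrderDual.ofDual (g i)).val := fun i j hij => hg hij
  have hbd (g : Fin n → (Fin (n + a))ᵒᵈ) (hg : StrictMono g) (i : Fin n) :
      n - 1 - (i : ℕ) ≤ (OrderDual.ofDual (g i)).val ∧
        (OrderDual.ofDual (g i)).val ≤ a + (n - 1 - (i : ℕ)) := by
    have hi := i.isLt
    have h0 : (⟨0, by omega⟩ : Fin n) ≤ i := Nat.zero_le _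
    have h1 : i ≤ (⟨n - 1, by omega⟩ : Fin n) := Nat.le_sub_one_of_lt hi
    have h2 := (hanti g hg).add_val_antitone h0
    have h3 := (hanti g hg).add_val_antitone h1
    have h4 := (OrderDual.ofDual (g ⟨0, by omega⟩)).isLt
    dsimp only at h2 h3
    omega
  refine Finset.sum_bij'
    (fun lam h i => OrderDual.toDual ⟨lam i + (n - 1 - (i : ℕ)), ?_⟩)
    (fun g _ i => (OrderDual.ofDual (g i)).val - (n - 1 - (i : ℕ))) ?_ ?_ ?_ ?_ ?_
  · simp only [mem_filter, Fintype.mem_piFinset, mem_range] at h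
    have := h.1 i
    omega
  · intro lam h
    simp only [mem_filter, Fintype.mem_piFinset, mem_range, mem_univ, true_and] at h ⊢
    intro i j hij
    have h1 := h.2 hij.le
    have h2 : (i : ℕ) < j := hij
    have h3 := j.isLt
    change lam j + (n - 1 - (j : ℕ)) < lam i + (n - 1 - (i : ℕ))
    omega
  · intro g hg
    simp only [mem_filter, Fintype.mem_piFinset, mem_range, mem_univ, true_and] at hg ⊢
    refine ⟨fun i => ?_, fun i j hij => ?_⟩
    · have := hbd g hg i
      omega
    · have h1 := (hanti g hg).add_val_antitone hij
      have h2 : (i : ℕ) ≤ j := hij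
      have h3 := j.isLt
      have h4 := hbd g hg i
      have h5 := hbd g hg j
      dsimp only at h1 ⊢
      omega
  · intro lam h
    ext i
    simp
  · intro g hg
    simp only [mem_filter, mem_univ, true_and] at hg
    ext i
    have := hbd g hg i
    change (OrderDual.ofDual (g i)).val - (n - 1 - (i : ℕ)) + (n - 1 - (i : ℕ)) = _
    exact Nat.sub_add_cancel this.1
  · intro lam h
    rfl

theorem MvPolynomial.det_X_pow_rev_ne_zero (n : ℕ) :
    (Matrix.of fun i j : Fin n =>
      (MvPolynomial.X j : MvPolynomial (Fin n) ℚ) ^ (n - 1 - (i : ℕ))).det ≠ 0 := by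
  have h : (Matrix.of fun i j : Fin n =>
      (MvPolynomial.X j : MvPolynomial (Fin n) ℚ) ^ (n - 1 - (i : ℕ))) =
      (Matrix.vandermonde (MvPolynomial.X : Fin n → MvPolynomial (Fin n) ℚ)).transpose.submatrix
        Fin.revPerm id := by
    ext1 i j
    simp [Matrix.vandermonde_apply, Fin.val_rev, Nat.sub_sub, add_comm]
  rw [h, Matrix.det_permute, Matrix.det_transpose]
  refine mul_ne_zero ?_ (Matrix.det_vandermonde_ne_zero_iff.2 (MvPolynomial.X_injective))
  rcases Int.units_eq_one_or (Equiv.Perm.sign (Fin.revPerm (n := n))) with h | h <;> simp [h]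

/-- The product of the alternant `det (X_j ^ (n - 1 - i))` with `∏ i, (1 + X_i + ⋯ + X_i ^ a)`,
expanded in alternants. -/
theorem MvPolynomial.det_X_pow_rev_mul_prod (n a : ℕ) :
    (Matrix.of fun i j : Fin n =>
        (MvPolynomial.X j : MvPolynomial (Fin n) ℚ) ^ (n - 1 - (i : ℕ))).det *
      ∏ i : Fin n, ∑ k ∈ Finset.range (a + 1), (MvPolynomial.X i : MvPolynomial (Fin n) ℚ) ^ k =
    ∑ lam ∈ Fintype.piFinset (fun _ : Fin n => range (a + 1)) with Antitone lam,
      (Matrix.of fun i j : Fin n =>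
          (MvPolynomial.X j : MvPolynomial (Fin n) ℚ) ^ (lam i + (n - 1 - (i : ℕ)))).det *
        MvPolynomial.C (Matrix.of fun i j : Fin n =>
          if (i : ℕ) ≤ lam i + (j : ℕ) ∧ lam i + (j : ℕ) - (i : ℕ) ≤ a then (1 : ℚ) else 0).det := by
  set A : Matrix (Fin n) (Fin (n + a))ᵒᵈ (MvPolynomial (Fin n) ℚ) := Matrix.of fun i m =>
    if n - 1 - (i : ℕ) ≤ (OrderDual.ofDual m).val ∧
      (OrderDual.ofDual m).val ≤ n - 1 - (i : ℕ) + a then 1 else 0 with hA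
  set B : Matrix (Fin (n + a))ᵒᵈ (Fin n) (MvPolynomial (Fin n) ℚ) := Matrix.of fun m j =>
    MvPolynomial.X j ^ (OrderDual.ofDual m).val with hB
  have hAB : (Matrix.of fun i j : Fin n =>
      (∑ k ∈ Finset.range (a + 1), (MvPolynomial.X j : MvPolynomial (Fin n) ℚ) ^ k) *
      (Matrix.of fun i j : Fin n =>
        (MvPolynomial.X j : MvPolynomial (Fin n) ℚ) ^ (n - 1 - (i : ℕ))) i j) = A * B := by
    ext1 i j
    have hi := i.isLt
    have hsum : ∑ m : Fin (n + a), (if n - 1 - (i : ℕ) ≤ (m : ℕ) ∧ (m : ℕ) ≤ n - 1 - (i : ℕ) + a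
        then (MvPolynomial.X j : MvPolynomial (Fin n) ℚ) ^ (m : ℕ) else 0) =
        (∑ k ∈ Finset.range (a + 1), (MvPolynomial.X j : MvPolynomial (Fin n) ℚ) ^ k) *
          MvPolynomial.X j ^ (n - 1 - (i : ℕ)) := by
      rw [Fin.sum_univ_eq_sum_range (fun m => if n - 1 - (i : ℕ) ≤ m ∧ m ≤ n - 1 - (i : ℕ) + a
        then (MvPolynomial.X j : MvPolynomial (Fin n) ℚ) ^ m else 0) (n + a),
        ← Finset.sum_filter, Finset.sum_mul]
      symm
      refine Finset.sum_bij' (fun k _ => k + (n - 1 - (i : ℕ)))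
        (fun m _ => m - (n - 1 - (i : ℕ))) ?_ ?_ ?_ ?_ ?_ <;>
        simp only [mem_filter, mem_range] <;> intro k hk <;> first | omega | rw [pow_add]
    rw [Matrix.mul_apply]
    simp only [hA, hB, Matrix.of_apply, ite_mul, one_mul, zero_mul]
    exact hsum.symm
  rw [mul_comm, ← Matrix.det_mul_row, hAB, Matrix.det_mul_eq_sum_strictMono]
  refine (sum_antitone_eq_sum_strictMono n a fun f : Fin n → ℕ =>
    (Matrix.of fun i j : Fin n => if n - 1 - (i : ℕ) ≤ f j ∧ f j ≤ n - 1 - (i : ℕ) + a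
      then (1 : MvPolynomial (Fin n) ℚ) else 0).det *
    (Matrix.of fun i j : Fin n =>
      (MvPolynomial.X j : MvPolynomial (Fin n) ℚ) ^ f i).det).symm.trans
    (Finset.sum_congr rfl fun lam _ => ?_)
  rw [mul_comm]
  congr 1
  rw [← Matrix.det_transpose, RingHom.map_det]
  congr 1
  ext1 i j
  have hi := i.isLt
  have hj := j.isLt
  simp only [Matrix.transpose_apply, Matrix.of_apply, RingHom.mapMatrix_apply, Matrix.map_apply,
    apply_ite MvPolynomial.C, map_one, map_zero]
  refine if_congr ?_ rfl rfl
  omega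

theorem stmt_15 (n a : ℕ)
    (s : (Fin n → ℕ) → MvPolynomial (Fin n) ℚ)
    (hs : ∀ lam : Fin n → ℕ, Antitone lam →
      s lam * (Matrix.of fun i j : Fin n =>
          (MvPolynomial.X j : MvPolynomial (Fin n) ℚ) ^ (n - 1 - (i : ℕ))).det
        = (Matrix.of fun i j : Fin n =>
          (MvPolynomial.X j : MvPolynomial (Fin n) ℚ) ^ (lam i + (n - 1 - (i : ℕ)))).det) :
    ∑ᶠ (lam : Fin n → ℕ) (_ : Antitone lam ∧ ∀ i : Fin n, lam i ≤ a),
        s lam * MvPolynomial.C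
          (Matrix.of fun i j : Fin n =>
            if (i : ℕ) ≤ lam i + (j : ℕ) ∧ lam i + (j : ℕ) - (i : ℕ) ≤ a then (1 : ℚ)
            else 0).det
    = ∏ i : Fin n, ∑ k ∈ Finset.range (a + 1),
        (MvPolynomial.X i : MvPolynomial (Fin n) ℚ) ^ k := by
  classical
  have hfin : ∀ lam : Fin n → ℕ, (Antitone lam ∧ ∀ i : Fin n, lam i ≤ a) ↔
      lam ∈ (Fintype.piFinset (fun _ : Fin n => range (a + 1))).filter Antitone := by
    intro lam
    simp [and_comm]
  simp_rw [hfin]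
  rw [finsum_mem_finset_eq_sum]
  refine mul_left_cancel₀ (MvPolynomial.det_X_pow_rev_ne_zero n) ?_
  rw [MvPolynomial.det_X_pow_rev_mul_prod, Finset.mul_sum]
  refine Finset.sum_congr rfl fun lam hlam => ?_
  rw [← hs lam (mem_filter.1 hlam).2]
  ring
end
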